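/- arXiv:2401.13994 — 2 statements merged into one kernel-verified Lean document; each statement's English description precedes it below -/
import Mathlib

section
/- Let p be an odd prime and let G be the split metacyclic p-group G = ⟨a, b | a^(p^n) = b^(p^m) = 1, b a b⁻¹ = a^r⟩ with n ≥ 2, m ≥ 1, gcd(r, p^n) = 1 and r of multiplicative order p^s modulo p^n, 1 ≤ s ≤ min{n−1, m}. Suppose n − s < m and write m = (n − s) + k with k > s. Then there is an isomorphism of ℚ-algebras ℚG ≅ ℚ ⊕ ⨁_{λ=1}^{n−s} (p^λ + p^{λ−1}) copies of ℚ(ζ_{p^λ}) ⊕ ⨁_{λ=n−s+1}^{m} p^{n−s} copies of ℚ(ζ_{p^λ}) ⊕ ⨁_{t=1}^{s} p^{n−s} copies of M_{p^t}(ℚ(ζ_{p^{n−s}})) ⊕ ⨁_{t=1}^{s} ⨁_{λ=n−s+1}^{m−t} (p^{n−s} − p^{n−s−1}) copies of M_{p^t}(ℚ(ζ_{p^λ})). -/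
set_option synthInstance.maxHeartbeats 1000000
set_option maxHeartbeats 1000000

lemma aux_lte {p : ℕ} (hp : p.Prime) (hodd : Odd p) {x : ℤ} (hx : (p : ℤ) ∣ x - 1) (k j : ℕ) :
    (p : ℤ) ^ (k + j) ∣ x ^ (p ^ j) - 1 ↔ (p : ℤ) ^ k ∣ x - 1 := by
  have hnx : ¬ (p : ℤ) ∣ x := by
    intro h
    have h1 : (p : ℤ) ∣ 1 := by
      have := dvd_sub h hx
      simpa using this
    have := Int.isUnit_iff.mp (isUnit_of_dvd_one h1)
    have := hp.two_le
    omega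
  have h := Int.emultiplicity_pow_sub_pow hp hodd (x := x) (y := 1) hx hnx (p ^ j)
  rw [one_pow] at h
  rw [pow_dvd_iff_le_emultiplicity, pow_dvd_iff_le_emultiplicity, h,
    emultiplicity_pow_self hp.ne_zero (by simpa using hp.ne_one)]
  push_cast
  exact ENat.add_le_add_iff_right (ENat.natCast_ne_top j)

lemma aux_geom {p : ℕ} (hp : p.Prime) (hodd : Odd p) {R : ℕ} (hR : (p : ℤ) ∣ (R : ℤ) - 1) (f : ℕ) :
    ∃ u : ℕ, ∑ i ∈ Finset.range (p ^ f), R ^ i = p ^ f * u ∧ Nat.Coprime u p := by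
  by_cases h1 : R = 1
  · exact ⟨1, by simp [h1], by simp⟩
  have hnx : ¬ (p : ℤ) ∣ (R : ℤ) := by
    intro h
    have h1 : (p : ℤ) ∣ 1 := by
      have := dvd_sub h hR
      simpa using this
    have := Int.isUnit_iff.mp (isUnit_of_dvd_one h1)
    have := hp.two_le
    omega
  have hg : (∑ i ∈ Finset.range (p ^ f), (R : ℤ) ^ i) * ((R : ℤ) - 1) = (R : ℤ) ^ (p ^ f) - 1 :=
    geom_sum_mul _ _
  have h := Int.emultiplicity_pow_sub_pow hp hodd (x := R) (y := 1) hR hnx (p ^ f)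
  rw [one_pow, ← hg, emultiplicity_mul (Nat.prime_iff_prime_int.mp hp),
    emultiplicity_pow_self hp.ne_zero (by simpa using hp.ne_one), add_comm] at h
  have hfin : emultiplicity (p : ℤ) ((R : ℤ) - 1) ≠ ⊤ := by
    rw [← finiteMultiplicity_iff_emultiplicity_ne_top, Int.finiteMultiplicity_iff]
    have := hp.ne_one
    refine ⟨by simpa using this, by omega⟩
  have h2 : emultiplicity (p : ℤ) (∑ i ∈ Finset.range (p ^ f), (R : ℤ) ^ i) = (f : ℕ∞) := by
    exact WithTop.add_left_cancel hfin h
  rw [emultiplicity_eq_coe] at h2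
  obtain ⟨hd, hnd⟩ := h2
  have hd' : p ^ f ∣ ∑ i ∈ Finset.range (p ^ f), R ^ i := by exact_mod_cast hd
  obtain ⟨u, hu⟩ := hd'
  refine ⟨u, hu, ?_⟩
  rw [Nat.coprime_comm, hp.coprime_iff_not_dvd]
  intro hpu
  apply hnd
  have : p ^ (f + 1) ∣ ∑ i ∈ Finset.range (p ^ f), R ^ i := by
    rw [hu, pow_succ]; exact mul_dvd_mul_left _ hpu
  exact_mod_cast this

lemma aux_zmod_pow (N R k : ℕ) : ((R : ZMod N)) ^ k = 1 ↔ (N : ℤ) ∣ (R : ℤ) ^ k - 1 := by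
  rw [← ZMod.intCast_zmod_eq_zero_iff_dvd, Int.cast_sub, sub_eq_zero]
  push_cast
  exact Iff.rfl

lemma aux_order {p n s R : ℕ} (hp : p.Prime) (hodd : Odd p) (hs : 1 ≤ s) (hsn : s ≤ n - 1)
    (hR : orderOf (R : ZMod (p ^ n)) = p ^ s) :
    ∀ t ≤ s, orderOf (R : ZMod (p ^ (n - s + t))) = p ^ t := by
  have := Fact.mk hp
  have hpow : (R : ZMod (p ^ n)) ^ (p ^ s) = 1 := by rw [← hR]; exact pow_orderOf_eq_one _
  have hnpow : ¬ (R : ZMod (p ^ n)) ^ (p ^ (s - 1)) = 1 := by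
    intro h
    have h1 := orderOf_dvd_of_pow_eq_one h
    rw [hR] at h1
    have := (Nat.pow_dvd_pow_iff_le_right hp.one_lt).mp h1
    omega
  rw [aux_zmod_pow] at hpow hnpow
  push_cast at hpow hnpow
  have hp1 : (p : ℤ) ∣ (R : ℤ) - 1 := by
    have h1 : (p : ℤ) ∣ (R : ℤ) ^ (p ^ s) - 1 := (dvd_pow_self _ (by omega)).trans hpow
    rw [← aux_zmod_pow, ZMod.pow_card_pow] at h1
    have := (aux_zmod_pow p R 1).mp (by simpa using h1)
    simpa using this
  have e1 : n = (n - s) + s := by omega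
  have e2 : n = (n - s + 1) + (s - 1) := by omega
  have hc : (p : ℤ) ^ (n - s) ∣ (R : ℤ) - 1 := by
    rw [← aux_lte hp hodd hp1 (n - s) s, ← e1]; exact hpow
  have hnc : ¬ (p : ℤ) ^ (n - s + 1) ∣ (R : ℤ) - 1 := by
    rw [← aux_lte hp hodd hp1 (n - s + 1) (s - 1), ← e2]; exact hnpow
  intro t ht
  rcases t with _ | t
  · rw [pow_zero, orderOf_eq_one_iff]
    have := (aux_zmod_pow (p ^ (n - s + 0)) R 1).mpr (by push_cast; simpa using hc)
    simpa using this
  · apply orderOf_eq_prime_pow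
    · rw [aux_zmod_pow]; push_cast
      rw [show n - s + (t + 1) = (n - s + 1) + t by omega, aux_lte hp hodd hp1]; exact hnc
    · rw [aux_zmod_pow]; push_cast
      rw [aux_lte hp hodd hp1]; exact hc

open Polynomial in
/-- base representation on `K[x]/(x^d - w)` -/
lemma aux_base {K : Type} [Field K] (d : ℕ) (hd : 0 < d) (w : K) (M : ℕ) (hwM : w ^ M = 1)
    (R T : ℕ) (hRT : R * T ≡ 1 [MOD (d * M)]) (hT : T ≡ 1 [MOD M])
    (hTd : T ^ d ≡ 1 [MOD (d * M)])
    (g : ℕ) (u : ℕ) (hu : ∑ i ∈ Finset.range d, T ^ i = d * u) :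
    ∃ A B : Matrix (Fin d) (Fin d) K, A ^ d = algebraMap K _ w ∧
      B ^ d = algebraMap K _ (w ^ (g * u)) ∧ A * B = B * A ^ R := by
  set P : K[X] := X ^ d - C w with hP
  have hmonic : P.Monic := monic_X_pow_sub_C w hd.ne'
  have hP0 : P ≠ 0 := hmonic.ne_zero
  have hev : ∀ {S : Type} [CommRing S] (φ : K →+* S) (y : S), eval₂ φ y P = y ^ d - φ w := by
    intro S _ φ y
    rw [hP, eval₂_sub, eval₂_X_pow, eval₂_C]
  let x : AdjoinRoot P := AdjoinRoot.root P
  have hxd : x ^ d = algebraMap K _ w := by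
    have := AdjoinRoot.eval₂_root P
    rw [hev, sub_eq_zero] at this
    exact this
  have hxdM : x ^ (d * M) = 1 := by
    rw [pow_mul, hxd, ← map_pow, hwM, map_one]
  have hxmod : ∀ i j : ℕ, i ≡ j [MOD (d * M)] → x ^ i = x ^ j := fun i j h =>
    pow_eq_pow_of_modEq h hxdM
  let τ : AdjoinRoot P →ₐ[K] AdjoinRoot P := AdjoinRoot.liftAlgHom P (Algebra.ofId K _) (x ^ T) (by
    rw [hev, sub_eq_zero, ← pow_mul, mul_comm, pow_mul, hxd,
      ← map_pow]
    have := pow_eq_pow_of_modEq hT hwM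
    rw [this, pow_one]
    rfl)
  have hτ : τ x = x ^ T := by simp [τ, x]
  have hτi : ∀ i, (τ ^ i) x = x ^ (T ^ i) := by
    intro i
    induction i with
    | zero => simp
    | succ i ih => rw [pow_succ, AlgHom.mul_apply, hτ, map_pow, ih, ← pow_mul, pow_succ]
  have hτd : τ ^ d = 1 := by
    apply AdjoinRoot.algHom_ext
    have := hτi d
    rw [hxmod _ _ hTd, pow_one] at this
    exact this
  let A : Module.End K (AdjoinRoot P) := LinearMap.mulLeft K x
  let B : Module.End K (AdjoinRoot P) := LinearMap.mulLeft K (x ^ g) * τ.toLinearMap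
  have hA : ∀ (i : ℕ) y, (A ^ i) y = x ^ i * y := by
    intro i y
    rw [LinearMap.pow_mulLeft]; rfl
  have hBi : ∀ (i : ℕ) y, (B ^ i) y = x ^ (g * ∑ j ∈ Finset.range i, T ^ j) * (τ ^ i) y := by
    intro i
    induction i with
    | zero => intro y; simp
    | succ i ih =>
      intro y
      rw [pow_succ', Module.End.mul_apply, ih]
      change x ^ g * τ (_ * _) = _
      rw [map_mul, map_pow, hτ, geom_sum_succ, pow_succ', AlgHom.mul_apply, ← mul_assoc,
        ← pow_mul, ← pow_add]
      congr 2; ring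
  have hAd : A ^ d = algebraMap K _ w := by
    ext1 y
    rw [hA, hxd, Module.algebraMap_end_apply, Algebra.smul_def]
  have hBd : B ^ d = algebraMap K _ (w ^ (g * u)) := by
    ext1 y
    rw [hBi, hτd, hu, Module.algebraMap_end_apply, Algebra.smul_def, map_pow, ← hxd, ← pow_mul]
    simp only [AlgHom.one_apply]
    congr 2; ring
  have hAB : A * B = B * A ^ R := by
    ext1 y
    rw [Module.End.mul_apply (B) (A ^ R), hA]
    change x * (x ^ g * τ y) = x ^ g * τ (_ * _)
    rw [map_mul, map_pow, hτ, ← pow_mul, hxmod (T * R) 1 (by rw [mul_comm T R]; exact hRT)]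
    ring
  let pb := AdjoinRoot.powerBasis hP0
  have : Module.Finite K (AdjoinRoot P) := pb.finite
  have hfr : Module.finrank K (AdjoinRoot P) = d := by
    rw [pb.finrank, AdjoinRoot.powerBasis_dim, hP, natDegree_X_pow_sub_C]
  let e := algEquivMatrix (Module.finBasisOfFinrankEq K (AdjoinRoot P) hfr)
  refine ⟨e A, e B, ?_, ?_, ?_⟩
  · rw [← map_pow, hAd, AlgEquiv.commutes]
  · rw [← map_pow, hBd, AlgEquiv.commutes]
  · rw [← map_pow, ← map_mul, hAB, map_mul]

/-- induced representation -/
lemma aux_induce {K : Type} [Field K] (q d : ℕ) (hq : 0 < q) (R : ℕ) (w η : K)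
    (A₁ B₁ : Matrix (Fin d) (Fin d) K) (hA : A₁ ^ d = algebraMap K _ w)
    (hB : B₁ ^ d = algebraMap K _ η) (hAB : A₁ * B₁ = B₁ * A₁ ^ (R ^ q))
    (hw : (w ^ q) ^ R = w ^ q) :
    ∃ A B : Matrix (Fin (q * d)) (Fin (q * d)) K, A ^ (q * d) = algebraMap K _ (w ^ q) ∧
      B ^ (q * d) = algebraMap K _ η ∧ A * B = B * A ^ R := by
  let e₁ := Matrix.toLinAlgEquiv' (R := K) (n := Fin d)
  let α := e₁ A₁
  let β := e₁ B₁
  have hα : α ^ d = algebraMap K _ w := by rw [← map_pow, hA, AlgEquiv.commutes]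
  have hβ : β ^ d = algebraMap K _ η := by rw [← map_pow, hB, AlgEquiv.commutes]
  have hαβ : α * β = β * α ^ (R ^ q) := by rw [← map_mul, hAB, map_mul, map_pow]
  let A : Module.End K (Fin q → Fin d → K) := LinearMap.pi fun i => (α ^ (R ^ i.1)) ∘ₗ LinearMap.proj i
  let B : Module.End K (Fin q → Fin d → K) := LinearMap.pi fun i =>
    if i.1 = 0 then β ∘ₗ LinearMap.proj ⟨q - 1, by omega⟩
    else LinearMap.proj ⟨i.1 - 1, by omega⟩
  have hAi : ∀ (k : ℕ) (v : Fin q → Fin d → K) i, (A ^ k) v i = (α ^ (R ^ i.1 * k)) (v i) := by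
    intro k
    induction k with
    | zero => intro v i; simp
    | succ k ih =>
      intro v i
      rw [pow_succ, Module.End.mul_apply, ih, mul_add, mul_one, pow_add, Module.End.mul_apply]
      rfl
  have hB0 : ∀ (v : Fin q → Fin d → K) (i : Fin q), i.1 = 0 → B v i = β (v ⟨q - 1, by omega⟩) := by
    intro v i hi
    simp [B, hi]
  have hB1 : ∀ (v : Fin q → Fin d → K) (i : Fin q), i.1 ≠ 0 → B v i = v ⟨i.1 - 1, by omega⟩ := by
    intro v i hi
    simp [B, hi]
  have hBk : ∀ k ≤ q, ∀ (v : Fin q → Fin d → K) (i : Fin q), (B ^ k) v i =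
      if h : k ≤ i.1 then v ⟨i.1 - k, by omega⟩ else β (v ⟨(i.1 + q - k) % q, Nat.mod_lt _ hq⟩) := by
    intro k
    induction k with
    | zero => intro _ v i; simp
    | succ k ih =>
      intro hk v i
      rw [pow_succ, Module.End.mul_apply, ih (by omega)]
      by_cases h1 : k + 1 ≤ i.1
      · rw [dif_pos (by omega), dif_pos h1, hB1 _ _ (by simp; omega)]
        rfl
      · rw [dif_neg h1]
        by_cases h2 : k ≤ i.1
        · rw [dif_pos h2, hB0 _ _ (by simp; omega)]
          congr 3
          rw [Nat.mod_eq_of_lt (by omega)]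
          omega
        · have h3 : (i.1 + q - k) % q = i.1 + q - k := Nat.mod_eq_of_lt (by omega)
          have h4 : (i.1 + q - (k + 1)) % q = i.1 + q - (k + 1) := Nat.mod_eq_of_lt (by omega)
          rw [dif_neg h2, hB1 _ _ (by simp only [h3]; omega)]
          congr 3
          simp only [h3, h4]; omega
  have hBq : ∀ (v : Fin q → Fin d → K) i, (B ^ q) v i = β (v i) := by
    intro v i
    rw [hBk q le_rfl, dif_neg (by omega)]
    congr 2
    ext
    simp [Nat.mod_eq_of_lt i.2]
  have hBqk : ∀ (k : ℕ) (v : Fin q → Fin d → K) i, ((B ^ q) ^ k) v i = (β ^ k) (v i) := by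
    intro k
    induction k with
    | zero => intro v i; simp
    | succ k ih =>
      intro v i
      rw [pow_succ, Module.End.mul_apply, ih, hBq, pow_succ, Module.End.mul_apply]
  have hwR : ∀ k : ℕ, (w ^ q) ^ (R ^ k) = w ^ q := by
    intro k
    induction k with
    | zero => simp
    | succ k ih => rw [pow_succ, pow_mul, ih, hw]
  have hAqd : A ^ (q * d) = algebraMap K _ (w ^ q) := by
    refine LinearMap.ext fun v => funext fun i => ?_
    rw [hAi, show R ^ i.1 * (q * d) = d * (q * R ^ i.1) by ring, pow_mul, hα, ← map_pow, pow_mul,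
      hwR]
    rfl
  have hBqd : B ^ (q * d) = algebraMap K _ η := by
    refine LinearMap.ext fun v => funext fun i => ?_
    rw [pow_mul, hBqk, hβ]
    rfl
  have hABR : A * B = B * A ^ R := by
    refine LinearMap.ext fun v => funext fun i => ?_
    rw [Module.End.mul_apply, Module.End.mul_apply]
    have hA1 := hAi 1 (B v) i
    rw [pow_one, mul_one] at hA1
    rw [hA1]
    by_cases hi : i.1 = 0
    · rw [hB0 _ _ hi, hB0 _ _ hi, hAi, hi, pow_zero, pow_one, ← pow_succ, Nat.sub_add_cancel hq]
      have := LinearMap.congr_fun hαβ (v ⟨q - 1, by omega⟩)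
      simpa only [Module.End.mul_apply] using this
    · rw [hB1 _ _ hi, hB1 _ _ hi, hAi]
      simp only
      rw [← pow_succ, Nat.sub_add_cancel (by omega)]
  have hfr : Module.finrank K (Fin q → Fin d → K) = q * d := by
    rw [Module.finrank_pi_fintype]; simp
  let e := algEquivMatrix (Module.finBasisOfFinrankEq K (Fin q → Fin d → K) hfr)
  refine ⟨e A, e B, ?_, ?_, ?_⟩
  · rw [← map_pow, hAqd, AlgEquiv.commutes]
  · rw [← map_pow, hBqd, AlgEquiv.commutes]
  · rw [← map_pow, ← map_mul, hABR, map_mul]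

lemma aux_modEq_of_order {N R k : ℕ} (h : orderOf (R : ZMod N) = k) : R ^ k ≡ 1 [MOD N] := by
  rw [← ZMod.natCast_eq_natCast_iff]
  push_cast
  rw [← h]; exact pow_orderOf_eq_one _

lemma aux_rep {K : Type} [Field K] {p c s R T : ℕ} (hp : p.Prime) (hodd : Odd p) (hc : 1 ≤ c)
    (hR : ∀ t ≤ s, orderOf (R : ZMod (p ^ (c + t))) = p ^ t)
    (hT : ∀ t ≤ s, orderOf (T : ZMod (p ^ (c + t))) = p ^ t)
    (hRT : R * T ≡ 1 [MOD p ^ (c + s)])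
    {t : ℕ} (ht : t ≤ s) {l : ℕ} (hl : c ≤ l) {ω w η : K} (hω : IsPrimitiveRoot ω (p ^ l))
    (hw : IsPrimitiveRoot w (p ^ c)) (hη : η ^ (p ^ l) = 1) :
    ∃ A B : Matrix (Fin (p ^ t)) (Fin (p ^ t)) K, A ^ (p ^ t) = algebraMap K _ w ∧
      B ^ (p ^ t) = algebraMap K _ η ∧ A * B = B * A ^ R := by
  have := Fact.mk hp
  have hp0 : ∀ k, 0 < p ^ k := fun k => pow_pos hp.pos k
  have : ∀ k, NeZero (p ^ k) := fun k => ⟨(hp0 k).ne'⟩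
  obtain ⟨e, f, hef, hel, hcase⟩ : ∃ e f, e + f = t ∧ c + e ≤ l ∧ (f = 0 ∨ c + e = l) := by
    rcases Nat.le_total t (l - c) with h | h
    · exact ⟨t, 0, by omega, by omega, Or.inl rfl⟩
    · exact ⟨l - c, t - (l - c), by omega, by omega, Or.inr (by omega)⟩
  obtain ⟨w', hw', hw'1⟩ : ∃ w' : K, w' ^ (p ^ e) = w ∧ w' ^ (p ^ (c + e)) = 1 := by
    have h1 : IsPrimitiveRoot (ω ^ (p ^ (l - c))) (p ^ c) :=
      hω.pow (hp0 _) (by rw [← pow_add]; congr 1; omega)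
    obtain ⟨i, -, hi⟩ := h1.eq_pow_of_pow_eq_one hw.pow_eq_one
    have key : (ω ^ (p ^ (l - c - e) * i)) ^ (p ^ e) = w := by
      rw [← hi, ← pow_mul, ← pow_mul, mul_right_comm, ← pow_add]
      congr 3; omega
    refine ⟨ω ^ (p ^ (l - c - e) * i), key, ?_⟩
    rw [add_comm, pow_add, pow_mul, key, hw.pow_eq_one]
  have hw'R : w' ^ (R ^ (p ^ e)) = w' := by
    have := pow_eq_pow_of_modEq (aux_modEq_of_order (hR e (by omega))) hw'1
    rwa [pow_one] at this
  have hwR : w ^ R = w := by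
    have h0 := aux_modEq_of_order (hR 0 (by omega))
    simp only [pow_zero, pow_one, add_zero] at h0
    have := pow_eq_pow_of_modEq h0 hw.pow_eq_one
    rwa [pow_one] at this
  have hbase : ∃ A B : Matrix (Fin (p ^ f)) (Fin (p ^ f)) K, A ^ (p ^ f) = algebraMap K _ w' ∧
      B ^ (p ^ f) = algebraMap K _ η ∧ A * B = B * A ^ (R ^ (p ^ e)) := by
    rcases hcase with h | h
    · subst h
      refine ⟨algebraMap K _ w', algebraMap K _ η, (map_pow _ _ _).symm.trans (congrArg _ (by simp)),
        (map_pow _ _ _).symm.trans (congrArg _ (by simp)), ?_⟩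
      rw [← map_pow, ← map_mul, ← map_mul, hw'R, mul_comm]
    · have hprim : IsPrimitiveRoot w' (p ^ l) := by
        obtain ⟨l', rfl⟩ : ∃ l', l = l' + 1 := ⟨l - 1, by omega⟩
        have : orderOf w' = p ^ (l' + 1) := by
          apply orderOf_eq_prime_pow
          · intro h1
            have h2 : w ^ (p ^ (c - 1)) = 1 := by
              rw [← hw', ← pow_mul, ← pow_add]
              rw [← h1]; congr 2; omega
            have h3 := hw.dvd_of_pow_eq_one _ h2
            have := (Nat.pow_dvd_pow_iff_le_right hp.one_lt).mp h3
            omega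
          · rw [← h]; exact hw'1
        rw [← this]; exact IsPrimitiveRoot.orderOf w'
      have hTe : T ^ (p ^ e) ≡ 1 [MOD p ^ (c + e)] := aux_modEq_of_order (hT e (by omega))
      have hTt : T ^ (p ^ t) ≡ 1 [MOD p ^ (c + t)] := aux_modEq_of_order (hT t ht)
      have hpT : (p : ℤ) ∣ ((T ^ (p ^ e) : ℕ) : ℤ) - 1 := by
        have h1 : T ^ (p ^ e) ≡ 1 [MOD p] := hTe.of_dvd (dvd_pow_self p (by omega))
        have := (Nat.modEq_iff_dvd.mp h1.symm)
        simpa using this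
      obtain ⟨u, hu, hup⟩ := aux_geom hp hodd hpT f
      have hpu : IsPrimitiveRoot (w' ^ u) (p ^ l) :=
        hprim.pow_of_coprime u (Nat.Coprime.pow_right l hup)
      obtain ⟨g, -, hg⟩ := hpu.eq_pow_of_pow_eq_one hη
      have hdM : p ^ f * p ^ (c + e) = p ^ (c + t) := by rw [← pow_add]; congr 1; omega
      have := aux_base (p ^ f) (hp0 f) w' (p ^ (c + e)) hw'1 (R ^ (p ^ e)) (T ^ (p ^ e))
        (by
          rw [hdM, ← mul_pow]
          have h1 : R * T ≡ 1 [MOD p ^ (c + t)] := hRT.of_dvd (pow_dvd_pow _ (by omega))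
          have := h1.pow (p ^ e)
          rwa [one_pow] at this) hTe
        (by rw [hdM, ← pow_mul, ← pow_add, hef]; exact hTt) g u hu
      rw [mul_comm g u, pow_mul, hg] at this
      exact this
  obtain ⟨A₁, B₁, h1, h2, h3⟩ := hbase
  have := aux_induce (p ^ e) (p ^ f) (hp0 e) R w' η A₁ B₁ h1 h2 h3 (by rw [hw', hwR])
  rw [← pow_add, hef, hw'] at this
  exact this

lemma aux_comm {M : Type*} [Monoid M] {A B : M} {R : ℕ} (h : A * B = B * A ^ R) (i j : ℕ) :
    A ^ i * B ^ j = B ^ j * A ^ (i * R ^ j) := by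
  have h1 : ∀ i, A ^ i * B = B * A ^ (i * R) := by
    intro i
    induction i with
    | zero => simp
    | succ i ih => rw [pow_succ, mul_assoc, h, ← mul_assoc, ih, mul_assoc, ← pow_add, add_mul, one_mul]
  induction j with
  | zero => simp
  | succ j ih => rw [pow_succ, ← mul_assoc, ih, mul_assoc, h1, ← mul_assoc, pow_succ R, mul_assoc i]

lemma aux_mul {M : Type*} [Monoid M] {A B : M} {R : ℕ} (h : A * B = B * A ^ R) (i j i' j' : ℕ) :
    (B ^ j * A ^ i) * (B ^ j' * A ^ i') = B ^ (j + j') * A ^ (i * R ^ j' + i') := by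
  rw [mul_assoc, ← mul_assoc (A ^ i), aux_comm h, pow_add, pow_add]
  simp only [mul_assoc]

lemma aux_surj {G : Type*} [Group G] [Finite G] {a b : G} {R : ℕ} (h : a * b = b * a ^ R)
    (hgen : Subgroup.closure {a, b} = ⊤) (g : G) : ∃ j i : ℕ, g = b ^ j * a ^ i := by
  have hg : g ∈ Submonoid.closure ({a, b} : Set G) := by
    rw [← Subgroup.closure_toSubmonoid_of_finite, hgen]; trivial
  induction hg using Submonoid.closure_induction with
  | mem x hx =>
    rcases hx with rfl | rfl
    · exact ⟨0, 1, by simp⟩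
    · exact ⟨1, 0, by simp⟩
  | one => exact ⟨0, 0, by simp⟩
  | mul x y _ _ hx hy =>
    obtain ⟨j, i, rfl⟩ := hx
    obtain ⟨j', i', rfl⟩ := hy
    exact ⟨_, _, aux_mul h _ _ _ _⟩

lemma aux_bij {G : Type*} [Group G] [Finite G] {a b : G} {R N M : ℕ} (h : a * b = b * a ^ R)
    (hgen : Subgroup.closure {a, b} = ⊤) (ha : orderOf a = N) (hb : orderOf b = M)
    (hcard : Nat.card G = M * N) :
    Function.Bijective (fun x : Fin M × Fin N => b ^ x.1.1 * a ^ x.2.1) := by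
  have hN : 0 < N := by rw [← ha]; exact orderOf_pos a
  have hM : 0 < M := by rw [← hb]; exact orderOf_pos b
  rw [Nat.bijective_iff_surjective_and_card]
  refine ⟨fun g => ?_, by simp [hcard]⟩
  obtain ⟨j, i, rfl⟩ := aux_surj h hgen g
  refine ⟨(⟨j % M, Nat.mod_lt _ hM⟩, ⟨i % N, Nat.mod_lt _ hN⟩), ?_⟩
  simp only [← ha, ← hb, pow_mod_orderOf]

lemma aux_lift {G : Type*} [Group G] [Finite G] {a b : G} {R N M : ℕ} (h : a * b = b * a ^ R)
    (hgen : Subgroup.closure {a, b} = ⊤) (ha : orderOf a = N) (hb : orderOf b = M)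
    (hcard : Nat.card G = M * N) {H : Type*} [Monoid H] (A B : H) (hA : A ^ N = 1) (hB : B ^ M = 1)
    (hAB : A * B = B * A ^ R) : ∃ f : G →* H, f a = A ∧ f b = B := by
  have hN : 0 < N := by rw [← ha]; exact orderOf_pos a
  have hM : 0 < M := by rw [← hb]; exact orderOf_pos b
  have hbij := aux_bij h hgen ha hb hcard
  choose j i hij using aux_surj h hgen
  have key : ∀ k l k' l' : ℕ, b ^ k * a ^ l = b ^ k' * a ^ l' → B ^ k * A ^ l = B ^ k' * A ^ l' := by
    intro k l k' l' he
    have := @hbij.1 (⟨k % M, Nat.mod_lt _ hM⟩, ⟨l % N, Nat.mod_lt _ hN⟩)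
      (⟨k' % M, Nat.mod_lt _ hM⟩, ⟨l' % N, Nat.mod_lt _ hN⟩) (by
        simp only [← ha, ← hb, pow_mod_orderOf]; exact he)
    simp only [Prod.mk.injEq, Fin.mk.injEq] at this
    rw [pow_eq_pow_of_modEq (show k ≡ k' [MOD M] from this.1) hB,
      pow_eq_pow_of_modEq (show l ≡ l' [MOD N] from this.2) hA]
  have hval : ∀ k l, B ^ (j (b ^ k * a ^ l)) * A ^ (i (b ^ k * a ^ l)) = B ^ k * A ^ l :=
    fun k l => key _ _ _ _ (hij _).symm
  refine ⟨⟨⟨fun g => B ^ (j g) * A ^ (i g), ?_⟩, ?_⟩, ?_, ?_⟩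
  · have := hval 0 0
    simpa using this
  · intro x y
    rw [aux_mul hAB]
    apply key
    rw [← hij, ← aux_mul h, ← hij, ← hij]
  · have := hval 0 1
    simpa using this
  · have := hval 1 0
    simpa using this

lemma aux_sum_range_mul {α : Type*} [AddCommMonoid α] (f : ℕ → α) (Q M : ℕ) :
    ∑ j ∈ Finset.range (Q * M), f j
      = ∑ j₀ ∈ Finset.range Q, ∑ q ∈ Finset.range M, f (j₀ + Q * q) := by
  rw [Finset.sum_comm]
  induction M with
  | zero => simp
  | succ M ih =>
    rw [Nat.mul_succ, Finset.sum_range_add, ih, Finset.sum_range_succ]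
    congr 1
    exact Finset.sum_congr rfl fun i _ => by rw [add_comm]

lemma aux_vanish {G : Type*} [Group G] [Fintype G] {a b : G} {R N M Q M' : ℕ}
    (h : a * b = b * a ^ R)
    (hbij : Function.Bijective (fun x : Fin M × Fin N => b ^ x.1.1 * a ^ x.2.1))
    (hQM : M = Q * M')
    {V : Type*} [AddCommGroup V] [Module ℂ V] (ψ : G →* Module.End ℂ V) (v : V) (hv : v ≠ 0)
    (ζ η : ℂ) (hζ : ψ a v = ζ • v) (hη : ((ψ b) ^ Q) v = η • v)
    (hinj : ∀ i < Q, ∀ j < Q, ζ ^ (R ^ i) = ζ ^ (R ^ j) → i = j)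
    (x : G → ℂ) (hx : ∑ g, x g • ψ g v = 0) :
    ∀ j₀ < Q, ∑ q ∈ Finset.range M',
      (∑ i ∈ Finset.range N, x (b ^ (j₀ + Q * q) * a ^ i) * ζ ^ i) * η ^ q = 0 := by
  have hζi : ∀ i : ℕ, ((ψ a) ^ i) v = ζ ^ i • v := by
    intro i
    induction i with
    | zero => simp
    | succ i ih => rw [pow_succ', Module.End.mul_apply, ih, map_smul, hζ, smul_smul, pow_succ]
  have hηi : ∀ i : ℕ, ((ψ b) ^ (Q * i)) v = η ^ i • v := by
    intro i
    rw [pow_mul]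
    induction i with
    | zero => simp
    | succ i ih => rw [pow_succ', Module.End.mul_apply, ih, map_smul, hη, smul_smul, pow_succ]
  have hψ : ψ a * ψ b = ψ b * (ψ a) ^ R := by rw [← map_mul, h, map_mul, map_pow]
  have hli : LinearIndependent ℂ (fun i : Fin Q => ((ψ b) ^ i.1) v) := by
    apply Module.End.eigenvectors_linearIndependent' (ψ a) (fun i : Fin Q => ζ ^ (R ^ i.1))
    · intro i j hij
      exact Fin.ext (hinj _ i.2 _ j.2 hij)
    · intro i
      rw [Module.End.hasEigenvector_iff]
      constructor
      · rw [Module.End.mem_eigenspace_iff]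
        have := congrArg (fun F : Module.End ℂ V => F v) (aux_comm hψ 1 i.1)
        simp only [Module.End.mul_apply, pow_one, one_mul] at this
        rw [this, hζi, map_smul]
      · intro h0
        apply hv
        have h2 : ψ ((b ^ i.1)⁻¹ * b ^ i.1) v = 0 := by
          rw [map_mul, Module.End.mul_apply, map_pow, h0, map_zero]
        simpa using h2
  have hsum : ∑ g, x g • ψ g v = ∑ j₀ : Fin Q, (∑ q ∈ Finset.range M',
      (∑ i ∈ Finset.range N, x (b ^ (j₀.1 + Q * q) * a ^ i) * ζ ^ i) * η ^ q) • ((ψ b) ^ j₀.1) v := by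
    rw [← Fintype.sum_bijective _ hbij (fun y => x (b ^ y.1.1 * a ^ y.2.1) • ψ (b ^ y.1.1 * a ^ y.2.1) v)
      (fun g => x g • ψ g v) (fun _ => rfl), Fintype.sum_prod_type]
    rw [Fin.sum_univ_eq_sum_range (fun j => ∑ y : Fin N, x (b ^ j * a ^ y.1) • ψ (b ^ j * a ^ y.1) v) M,
      hQM, aux_sum_range_mul, ← Fin.sum_univ_eq_sum_range (fun j₀ => ∑ q ∈ Finset.range M', ∑ y : Fin N, x (b ^ (j₀ + Q * q) * a ^ y.1) • ψ (b ^ (j₀ + Q * q) * a ^ y.1) v)]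
    refine Finset.sum_congr rfl fun j₀ _ => ?_
    rw [Finset.sum_smul]
    refine Finset.sum_congr rfl fun q _ => ?_
    rw [Finset.sum_mul, Finset.sum_smul, Fin.sum_univ_eq_sum_range (fun i => x (b ^ (j₀.1 + Q * q) * a ^ i) • ψ (b ^ (j₀.1 + Q * q) * a ^ i) v)]
    refine Finset.sum_congr rfl fun i _ => ?_
    rw [map_mul, map_pow, map_pow, Module.End.mul_apply, hζi, map_smul, pow_add (ψ b),
      Module.End.mul_apply, hηi, map_smul, smul_smul, smul_smul, mul_assoc]
  rw [hsum] at hx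
  intro j₀ hj₀
  have := Fintype.linearIndependent_iff.mp hli _ hx ⟨j₀, hj₀⟩
  exact this

open Polynomial in
lemma aux_fourier (y : ℕ → ℂ) (N : ℕ) (hN : 0 < N)
    (h : ∀ η : ℂ, η ^ N = 1 → ∑ q ∈ Finset.range N, y q * η ^ q = 0) : ∀ q < N, y q = 0 := by
  let P : ℂ[X] := ∑ q ∈ Finset.range N, C (y q) * X ^ q
  have hP : P = 0 := by
    apply Polynomial.eq_zero_of_natDegree_lt_card_of_eval_eq_zero' P (nthRootsFinset N (1 : ℂ))
    · intro i hi
      rw [mem_nthRootsFinset hN] at hi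
      simpa [P, eval_finsetSum] using h i hi
    · rw [(Complex.isPrimitiveRoot_exp N hN.ne').card_nthRootsFinset]
      have : P.natDegree ≤ N - 1 := by
        apply natDegree_sum_le_of_forall_le
        intro i hi
        rw [Finset.mem_range] at hi
        exact (natDegree_C_mul_X_pow_le _ _).trans (by omega)
      omega
  intro q hq
  have := congrArg (fun F => coeff F q) hP
  simpa [P, coeff_C_mul, coeff_X_pow, hq] using this

lemma aux_total {G : Type*} [Group G] {a b : G} {N M : ℕ} (hN : 0 < N)
    (hbij : Function.Bijective (fun x : Fin M × Fin N => b ^ x.1.1 * a ^ x.2.1))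
    (x : G → ℂ)
    (hx : ∀ ζ : ℂ, ζ ^ N = 1 → ∃ Q M', 0 < Q ∧ 0 < M' ∧ M = Q * M' ∧
      ∀ η : ℂ, η ^ M' = 1 → ∀ j₀ < Q, ∑ q ∈ Finset.range M',
        (∑ i ∈ Finset.range N, x (b ^ (j₀ + Q * q) * a ^ i) * ζ ^ i) * η ^ q = 0) :
    x = 0 := by
  have h1 : ∀ j < M, ∀ ζ : ℂ, ζ ^ N = 1 →
      ∑ i ∈ Finset.range N, x (b ^ j * a ^ i) * ζ ^ i = 0 := by
    intro j hj ζ hζ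
    obtain ⟨Q, M', hQ, hM', rfl, hx'⟩ := hx ζ hζ
    have := aux_fourier (fun q => ∑ i ∈ Finset.range N, x (b ^ (j % Q + Q * q) * a ^ i) * ζ ^ i) M' hM'
      (fun η hη => hx' η hη (j % Q) (Nat.mod_lt _ hQ)) (j / Q) (Nat.div_lt_of_lt_mul hj)
    simpa only [Nat.mod_add_div] using this
  funext g
  obtain ⟨⟨j, i⟩, rfl⟩ := hbij.2 g
  exact aux_fourier (fun i => x (b ^ j.1 * a ^ i)) N hN (h1 j.1 j.2) i.1 i.2

open Polynomial in
lemma aux_eigen {V : Type*} [AddCommGroup V] [Module ℂ V] [FiniteDimensional ℂ V] [Nontrivial V]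
    (A B : Module.End ℂ V) (hBu : IsUnit B) {R Q : ℕ} (hQ : 0 < Q) (h : A * B = B * A ^ R) (ζ : ℂ)
    (hA : A ^ Q = algebraMap ℂ _ (ζ ^ Q))
    (hR : (ζ ^ Q) ^ R = ζ ^ Q) (hRQ : ζ ^ (R ^ Q) = ζ)
    (hinj : ∀ i < Q, ∀ j < Q, ζ ^ (R ^ i) = ζ ^ (R ^ j) → i = j) :
    ∃ v : V, v ≠ 0 ∧ A v = ζ • v := by
  obtain ⟨ζ', hζ'⟩ := Module.End.exists_eigenvalue A
  obtain ⟨v, hv⟩ := hζ'.exists_hasEigenvector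
  have hvi : ∀ i : ℕ, (A ^ i) v = ζ' ^ i • v := fun i => hv.pow_apply i
  have hQe : ζ' ^ Q = ζ ^ Q := by
    have h1 := hvi Q
    rw [hA, Module.algebraMap_end_apply] at h1
    exact (smul_left_injective ℂ hv.2 h1).symm
  have hRi : ∀ i, (ζ ^ Q) ^ (R ^ i) = ζ ^ Q := by
    intro i
    induction i with
    | zero => simp
    | succ i ih => rw [pow_succ, pow_mul, ih, hR]
  have hmem : ζ' ∈ (Finset.range Q).image (fun i => ζ ^ (R ^ i)) := by
    have hsub : (Finset.range Q).image (fun i => ζ ^ (R ^ i)) ⊆ (nthRoots Q (ζ ^ Q)).toFinset := by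
      intro z hz
      obtain ⟨i, -, rfl⟩ := Finset.mem_image.mp hz
      rw [Multiset.mem_toFinset, mem_nthRoots hQ, ← pow_mul, mul_comm, pow_mul, hRi]
    have hcard : (nthRoots Q (ζ ^ Q)).toFinset.card ≤
        ((Finset.range Q).image (fun i => ζ ^ (R ^ i))).card := by
      rw [Finset.card_image_of_injOn, Finset.card_range]
      · exact (Multiset.toFinset_card_le _).trans (card_nthRoots _ _)
      · intro i hi j hj hij
        exact hinj i (by simpa using hi) j (by simpa using hj) hij
    rw [Finset.eq_of_subset_of_card_le hsub hcard, Multiset.mem_toFinset, mem_nthRoots hQ, hQe]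
  obtain ⟨i, hi, rfl⟩ := Finset.mem_image.mp hmem
  rw [Finset.mem_range] at hi
  refine ⟨(B ^ (Q - i)) v, ?_, ?_⟩
  · intro h0
    obtain ⟨u, hu⟩ := hBu.pow (Q - i)
    apply hv.2
    have : (u⁻¹.1 * u.1) v = 0 := by rw [Module.End.mul_apply, hu, h0, map_zero]
    simpa using this
  · have := congrArg (fun F : Module.End ℂ V => F v) (aux_comm h 1 (Q - i))
    simp only [Module.End.mul_apply, pow_one, one_mul] at this
    rw [this, hvi, map_smul, ← pow_mul, ← pow_add, Nat.add_sub_cancel' hi.le, hRQ]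

lemma aux_lift_apply {G : Type} [Group G] [Fintype G] {S : Type} [Ring S] [Algebra ℚ S]
    (f : G →* S) (x : MonoidAlgebra ℚ G) :
    MonoidAlgebra.lift ℚ S G f x = ∑ g, x.coeff g • f g := by
  rw [MonoidAlgebra.lift_apply, Finsupp.sum_fintype]
  simp

lemma aux_char {G : Type} [Group G] [Fintype G] {a b : G} {R N M : ℕ}
    (h : a * b = b * a ^ R)
    (hbij : Function.Bijective (fun x : Fin M × Fin N => b ^ x.1.1 * a ^ x.2.1))
    {K : Type} [CommRing K] [Algebra ℚ K] (f : G →* K) (σ : K →ₐ[ℚ] ℂ)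
    (x : MonoidAlgebra ℚ G) (hx : MonoidAlgebra.lift ℚ K G f x = 0)
    (ζ η : ℂ) (hζ : σ (f a) = ζ) (hη : σ (f b) = η) :
    ∀ j₀ < 1, ∑ q ∈ Finset.range M, (∑ i ∈ Finset.range N,
      (x.coeff (b ^ (j₀ + 1 * q) * a ^ i) : ℂ) * ζ ^ i) * η ^ q = 0 := by
  let ψ : G →* Module.End ℂ ℂ :=
    ((algebraMap ℂ (Module.End ℂ ℂ)).toMonoidHom.comp σ.toRingHom.toMonoidHom).comp f
  have hψ : ∀ g (v : ℂ), ψ g v = σ (f g) * v := fun g v => rfl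
  refine aux_vanish h hbij (by simp) ψ 1 one_ne_zero ζ η ?_ ?_ ?_
    (fun g => (x.coeff g : ℂ)) ?_
  · rw [hψ, hζ]; rfl
  · rw [pow_one, hψ, hη]; rfl
  · intro i hi j hj _; omega
  · rw [aux_lift_apply] at hx
    have := congrArg σ hx
    rw [map_sum, map_zero] at this
    rw [← this]
    refine Finset.sum_congr rfl fun g _ => ?_
    rw [hψ, map_smul, mul_one, smul_eq_mul, Rat.smul_def]

lemma aux_comp {G : Type} [Group G] [Fintype G] {a b : G} {R N M Q M' : ℕ} (hQ : 0 < Q)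
    (h : a * b = b * a ^ R)
    (hbij : Function.Bijective (fun x : Fin M × Fin N => b ^ x.1.1 * a ^ x.2.1))
    (hQM : M = Q * M')
    {K : Type} [Field K] [Algebra ℚ K] (f : G →* Matrix (Fin Q) (Fin Q) K) (σ : K →ₐ[ℚ] ℂ)
    (x : MonoidAlgebra ℚ G) (hx : MonoidAlgebra.lift ℚ (Matrix (Fin Q) (Fin Q) K) G f x = 0)
    (w η₀ : K) (hw : (f a) ^ Q = algebraMap K _ w) (hη₀ : (f b) ^ Q = algebraMap K _ η₀)
    (ζ η : ℂ) (hζ : σ w = ζ ^ Q) (hη : σ η₀ = η)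
    (hR : (ζ ^ Q) ^ R = ζ ^ Q) (hRQ : ζ ^ (R ^ Q) = ζ)
    (hinj : ∀ i < Q, ∀ j < Q, ζ ^ (R ^ i) = ζ ^ (R ^ j) → i = j) :
    ∀ j₀ < Q, ∑ q ∈ Finset.range M', (∑ i ∈ Finset.range N,
      (x.coeff (b ^ (j₀ + Q * q) * a ^ i) : ℂ) * ζ ^ i) * η ^ q = 0 := by
  have : Nonempty (Fin Q) := ⟨⟨0, hQ⟩⟩
  let e := Matrix.toLinAlgEquiv' (R := ℂ) (n := Fin Q)
  let ψ : G →* Module.End ℂ (Fin Q → ℂ) :=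
    (e.toRingEquiv.toRingHom.toMonoidHom.comp (σ.mapMatrix (m := Fin Q)).toRingHom.toMonoidHom).comp f
  have hψ : ∀ g, ψ g = e (σ.mapMatrix (f g)) := fun g => rfl
  have hsc : ∀ z : K, e (σ.mapMatrix (algebraMap K (Matrix (Fin Q) (Fin Q) K) z)) =
      algebraMap ℂ _ (σ z) := by
    intro z
    have : σ.mapMatrix (algebraMap K (Matrix (Fin Q) (Fin Q) K) z) = algebraMap ℂ _ (σ z) := by
      ext i j
      simp only [AlgHom.mapMatrix_apply, Matrix.map_apply, Matrix.algebraMap_matrix_apply]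
      split_ifs <;> simp
    rw [this, AlgEquiv.commutes]
  have hA : (ψ a) ^ Q = algebraMap ℂ _ (ζ ^ Q) := by
    rw [hψ, ← map_pow, ← map_pow, hw, hsc, hζ]
  have hB : (ψ b) ^ Q = algebraMap ℂ _ η := by
    rw [hψ, ← map_pow, ← map_pow, hη₀, hsc, hη]
  have hAB : ψ a * ψ b = ψ b * (ψ a) ^ R := by rw [← map_mul, h, map_mul, map_pow]
  obtain ⟨v, hv, hζv⟩ := aux_eigen (ψ a) (ψ b) ((Group.isUnit b).map ψ) hQ hAB ζ hA hR hRQ hinj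
  refine aux_vanish h hbij hQM ψ v hv ζ η hζv ?_ hinj (fun g => (x.coeff g : ℂ)) ?_
  · rw [hB, Module.algebraMap_end_apply]
  · rw [aux_lift_apply] at hx
    have := congrArg (fun m => e (σ.mapMatrix m) v) hx
    simp only [map_zero, LinearMap.zero_apply] at this
    rw [← this, map_sum, map_sum, LinearMap.sum_apply]
    refine Finset.sum_congr rfl fun g _ => ?_
    rw [hψ, map_smul]
    have : (x.coeff g) • (σ.mapMatrix (f g)) = ((x.coeff g : ℚ) : ℂ) • (σ.mapMatrix (f g)) := by
      ext i j
      simp [Rat.smul_def]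
    rw [this, map_smul, LinearMap.smul_apply]

lemma aux_embed (N : ℕ) [NeZero N] (K : Type) [Field K] [Algebra ℚ K]
    [IsCyclotomicExtension {N} ℚ K] (z : ℂ) (hz : IsPrimitiveRoot z N) :
    ∃ σ : K →ₐ[ℚ] ℂ, σ (IsCyclotomicExtension.zeta N ℚ K) = z := by
  have hζ := IsCyclotomicExtension.zeta_spec N ℚ K
  let E := hζ.embeddingsEquivPrimitiveRoots ℂ (Polynomial.cyclotomic.irreducible_rat (NeZero.pos N))
  let z' : primitiveRoots N ℂ := ⟨z, (mem_primitiveRoots (NeZero.pos N)).mpr hz⟩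
  refine ⟨E.symm z', ?_⟩
  have := hζ.embeddingsEquivPrimitiveRoots_apply_coe ℂ (Polynomial.cyclotomic.irreducible_rat (NeZero.pos N)) (E.symm z')
  rw [← this]
  change ((E (E.symm z')) : ℂ) = z
  rw [Equiv.apply_symm_apply]

lemma aux_arith (q c' s m : ℕ) (hm : c' + 1 + s ≤ m) :
    1 + (∑ l ∈ Finset.range (c' + 1), ((q + 1) ^ (l + 1) + (q + 1) ^ l) * ((q + 1) ^ l * q)
     + (∑ l ∈ Finset.range (m - (c' + 1)), (q + 1) ^ (c' + 1) * ((q + 1) ^ (c' + 1 + l) * q)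
     + (∑ j ∈ Finset.range s, (q + 1) ^ (c' + 1) * ((q + 1) ^ (j + 1) * (q + 1) ^ (j + 1) * ((q + 1) ^ c' * q))
     + ∑ j ∈ Finset.range s, ∑ l ∈ Finset.range (m - (j + 1) - (c' + 1)),
        ((q + 1) ^ c' * q) * ((q + 1) ^ (j + 1) * (q + 1) ^ (j + 1) * ((q + 1) ^ (c' + 1 + l) * q)))))
    = (q + 1) ^ (c' + 1 + s + m) := by
  have S1 : ∀ c, 1 + ∑ l ∈ Finset.range c, ((q + 1) ^ (l + 1) + (q + 1) ^ l) * ((q + 1) ^ l * q)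
      = (q + 1) ^ (2 * c) := by
    intro c
    induction c with
    | zero => simp
    | succ c ih => rw [Finset.sum_range_succ, ← add_assoc, ih]; ring
  have S2 : ∀ N, (q + 1) ^ (c' + 1) + ∑ l ∈ Finset.range N, (q + 1) ^ (c' + 1 + l) * q
      = (q + 1) ^ (c' + 1 + N) := by
    intro N
    induction N with
    | zero => simp
    | succ N ih => rw [Finset.sum_range_succ, ← add_assoc, ih]; ring
  have S3 : ∀ s' ≤ s, (q + 1) ^ (c' + 1 + m) + (∑ j ∈ Finset.range s', (q + 1) ^ (c' + 1) * ((q + 1) ^ (j + 1) * (q + 1) ^ (j + 1) * ((q + 1) ^ c' * q))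
     + ∑ j ∈ Finset.range s', ∑ l ∈ Finset.range (m - (j + 1) - (c' + 1)),
        ((q + 1) ^ c' * q) * ((q + 1) ^ (j + 1) * (q + 1) ^ (j + 1) * ((q + 1) ^ (c' + 1 + l) * q)))
      = (q + 1) ^ (c' + 1 + s' + m) := by
    intro s' hs'
    induction s' with
    | zero => simp
    | succ s' ih =>
      have ih := ih (by omega)
      rw [Finset.sum_range_succ, Finset.sum_range_succ]
      have h2 := S2 (m - (s' + 1) - (c' + 1))
      have hlast : ∑ l ∈ Finset.range (m - (s' + 1) - (c' + 1)),
          ((q + 1) ^ c' * q) * ((q + 1) ^ (s' + 1) * (q + 1) ^ (s' + 1) * ((q + 1) ^ (c' + 1 + l) * q))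
          = ((q + 1) ^ c' * q * ((q + 1) ^ (s' + 1) * (q + 1) ^ (s' + 1))) *
            ∑ l ∈ Finset.range (m - (s' + 1) - (c' + 1)), (q + 1) ^ (c' + 1 + l) * q := by
        rw [Finset.mul_sum]
        exact Finset.sum_congr rfl fun l _ => by ring
      rw [hlast]
      have hm' : (q + 1) ^ (c' + 1 + (s' + 1) + m) = (q + 1) ^ (c' + 1 + s' + m)
          + (q + 1) ^ c' * q * ((q + 1) ^ (s' + 1) * (q + 1) ^ (s' + 1)) * (q + 1) ^ (c' + 1 + (m - (s' + 1) - (c' + 1))) := by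
        have : (q + 1) ^ c' * q * ((q + 1) ^ (s' + 1) * (q + 1) ^ (s' + 1)) * (q + 1) ^ (c' + 1 + (m - (s' + 1) - (c' + 1)))
          = q * (q + 1) ^ (c' + 1 + s' + m) := by
          rw [show c' + 1 + s' + m = c' + ((s' + 1) + (s' + 1)) + (c' + 1 + (m - (s' + 1) - (c' + 1))) by omega]
          simp only [pow_add]; ring
        rw [this]; ring
      rw [hm', ← ih, ← h2]
      generalize ∑ l ∈ Finset.range (m - (s' + 1) - (c' + 1)), (q + 1) ^ (c' + 1 + l) * q = X
      generalize ∑ j ∈ Finset.range s', ∑ l ∈ Finset.range (m - (j + 1) - (c' + 1)), (_ : ℕ) = Y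
      generalize ∑ j ∈ Finset.range s', (_ : ℕ) = Z
      ring
  rw [← add_assoc, S1, ← add_assoc]
  have : (q + 1) ^ (2 * (c' + 1)) + ∑ l ∈ Finset.range (m - (c' + 1)), (q + 1) ^ (c' + 1) * ((q + 1) ^ (c' + 1 + l) * q) = (q + 1) ^ (c' + 1 + m) := by
    rw [← Finset.mul_sum, two_mul, pow_add _ (c' + 1) (c' + 1), ← mul_add, S2, ← pow_add]
    congr 1; omega
  rw [this, S3 s le_rfl]

lemma aux_finrank {G : Type} [Group G] [Finite G] (p c s m : ℕ) (hp : p.Prime) (hc : 1 ≤ c)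
    (hm : c + s ≤ m) (hcard : Nat.card G = p ^ (c + s + m))
    (K : ℕ → Type) [∀ N, Field (K N)] [∀ N, Algebra ℚ (K N)]
    [∀ N, IsCyclotomicExtension {N} ℚ (K N)] :
    Module.finrank ℚ (MonoidAlgebra ℚ G) = Module.finrank ℚ (ℚ ×
        ((l : Fin c) → Fin (p ^ (l.1 + 1) + p ^ l.1) → K (p ^ (l.1 + 1))) ×
        ((l : Fin (m - c)) → Fin (p ^ c) → K (p ^ (c + 1 + l.1))) ×
        ((j : Fin s) → Fin (p ^ c) →
          Matrix (Fin (p ^ (j.1 + 1))) (Fin (p ^ (j.1 + 1))) (K (p ^ c))) ×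
        ((j : Fin s) → (l : Fin (m - (j.1 + 1) - c)) → Fin (p ^ c - p ^ (c - 1)) →
          Matrix (Fin (p ^ (j.1 + 1))) (Fin (p ^ (j.1 + 1))) (K (p ^ (c + 1 + l.1))))) := by
  have hN : ∀ k, NeZero (p ^ k) := fun k => ⟨(pow_pos hp.pos k).ne'⟩
  have hfd : ∀ k, FiniteDimensional ℚ (K (p ^ k)) := fun k =>
    IsCyclotomicExtension.finiteDimensional {p ^ k} ℚ (K (p ^ k))
  have hfr : ∀ k, Module.finrank ℚ (K (p ^ (k + 1))) = p ^ k * (p - 1) := fun k => by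
    rw [IsCyclotomicExtension.finrank (n := p ^ (k + 1)) (K (p ^ (k + 1)))
      (Polynomial.cyclotomic.irreducible_rat (NeZero.pos _)), Nat.totient_prime_pow_succ hp]
  have : Fintype G := Fintype.ofFinite G
  rw [(MonoidAlgebra.coeffLinearEquiv ℚ).finrank_eq, Module.finrank_finsupp_self,
    ← Nat.card_eq_fintype_card, hcard]
  obtain ⟨c', rfl⟩ : ∃ c', c = c' + 1 := ⟨c - 1, by omega⟩
  obtain ⟨q, rfl⟩ : ∃ q, p = q + 1 := ⟨p - 1, by have := hp.pos; omega⟩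
  rw [← aux_arith q c' s m hm]
  have hfm : ∀ t k, FiniteDimensional ℚ (Matrix (Fin ((q + 1) ^ t)) (Fin ((q + 1) ^ t)) (K ((q + 1) ^ k))) :=
    fun t k => Module.Finite.matrix
  rw [Module.finrank_prod, Module.finrank_prod, Module.finrank_prod, Module.finrank_prod,
    Module.finrank_pi_fintype, Module.finrank_pi_fintype, Module.finrank_pi_fintype,
    Module.finrank_pi_fintype, Module.finrank_self]
  simp only [Module.finrank_pi_fintype, Module.finrank_matrix]
  have e1 : ∀ l, Module.finrank ℚ (K ((q + 1) ^ (c' + 1 + 1 + l))) = (q + 1) ^ (c' + 1 + l) * q := fun l => by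
    have := hfr (c' + 1 + l)
    rw [show c' + 1 + 1 + l = c' + 1 + l + 1 by omega, this, Nat.add_sub_cancel]
  have e2 : (q + 1) ^ (c' + 1) - (q + 1) ^ c' = (q + 1) ^ c' * q := by
    rw [pow_succ, mul_add, mul_one, Nat.add_sub_cancel]
  simp only [e1, hfr, e2, Finset.sum_const, Finset.card_univ, Fintype.card_fin, smul_eq_mul,
    Nat.add_sub_cancel, Finset.sum_range]

lemma aux_pow_one {H : Type*} [Monoid H] {p i j : ℕ} {x : H} (h : x ^ (p ^ i) = 1) (hij : i ≤ j) :
    x ^ (p ^ j) = 1 := by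
  rw [← Nat.sub_add_cancel hij, Nat.add_comm, pow_add, pow_mul, h, one_pow]

lemma aux_prim {p n : ℕ} (hp : p.Prime) {z : ℂ} (h : z ^ (p ^ n) = 1) :
    ∃ u ≤ n, IsPrimitiveRoot z (p ^ u) := by
  obtain ⟨u, hu, he⟩ := (Nat.dvd_prime_pow hp).1 (orderOf_dvd_of_pow_eq_one h)
  exact ⟨u, hu, he ▸ IsPrimitiveRoot.orderOf z⟩

lemma aux_primpow {H : Type*} [CommMonoid H] {p i j : ℕ} (hp : p.Prime) {z : H}
    (h : IsPrimitiveRoot z (p ^ (i + j))) : IsPrimitiveRoot (z ^ (p ^ j)) (p ^ i) :=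
  h.pow (pow_pos hp.pos _) (by rw [pow_add, mul_comm])

/-- existence of characters -/
lemma aux_exchar {G : Type} [Group G] [Finite G] {a b : G} {p c s m R : ℕ}
    (hR : R ≡ 1 [MOD p ^ c])
    (h : a * b = b * a ^ R) (hgen : Subgroup.closure {a, b} = ⊤)
    (ha : orderOf a = p ^ (c + s)) (hb : orderOf b = p ^ m)
    (hcard : Nat.card G = p ^ m * p ^ (c + s)) {K : Type} [Field K] (α β : K)
    (hα : α ^ (p ^ c) = 1) (hβ : β ^ (p ^ m) = 1) : ∃ f : G →* K, f a = α ∧ f b = β := by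
  refine aux_lift h hgen ha hb hcard α β (aux_pow_one hα (by omega)) hβ ?_
  rw [pow_eq_pow_of_modEq hR hα, pow_one, mul_comm]

/-- existence of the matrix representations -/
lemma aux_exmat {G : Type} [Group G] [Finite G] {a b : G} {p c s m R T : ℕ}
    (hp : p.Prime) (hodd : Odd p) (hc : 1 ≤ c) (hm : c + s < m)
    (hR : ∀ t ≤ s, orderOf (R : ZMod (p ^ (c + t))) = p ^ t)
    (hT : ∀ t ≤ s, orderOf (T : ZMod (p ^ (c + t))) = p ^ t)
    (hRT : R * T ≡ 1 [MOD p ^ (c + s)])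
    (h : a * b = b * a ^ R) (hgen : Subgroup.closure {a, b} = ⊤)
    (ha : orderOf a = p ^ (c + s)) (hb : orderOf b = p ^ m)
    (hcard : Nat.card G = p ^ m * p ^ (c + s)) {K : Type} [Field K] {t l : ℕ} (ht : t ≤ s)
    (hl : c ≤ l) (hlm : l + t ≤ m) {ω w η : K} (hω : IsPrimitiveRoot ω (p ^ l))
    (hw : IsPrimitiveRoot w (p ^ c)) (hη : η ^ (p ^ l) = 1) :
    ∃ f : G →* Matrix (Fin (p ^ t)) (Fin (p ^ t)) K,
      (f a) ^ (p ^ t) = algebraMap K _ w ∧ (f b) ^ (p ^ t) = algebraMap K _ η := by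
  obtain ⟨A, B, hA, hB, hAB⟩ := aux_rep hp hodd hc hR hT hRT ht hl hω hw hη
  have hA1 : A ^ (p ^ (t + c)) = 1 := by
    rw [pow_add, pow_mul, hA, ← map_pow, hw.pow_eq_one, map_one]
  have hB1 : B ^ (p ^ (t + l)) = 1 := by
    rw [pow_add, pow_mul, hB, ← map_pow, hη, map_one]
  obtain ⟨f, hfa, hfb⟩ := aux_lift h hgen ha hb hcard A B (aux_pow_one hA1 (by omega))
    (aux_pow_one hB1 (by omega)) hAB
  exact ⟨f, by rw [hfa, hA], by rw [hfb, hB]⟩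

lemma aux_c2 {G : Type} [Group G] {a b : G} {p c m l : ℕ} (hl : l < c) (hcm : c ≤ m)
    {K : Type} [Field K]
    (ex : ∀ α β : K, α ^ (p ^ c) = 1 → β ^ (p ^ m) = 1 → ∃ f : G →* K, f a = α ∧ f b = β)
    (ω : K) (hω : ω ^ (p ^ (l + 1)) = 1) :
    ∃ F : Fin (p ^ (l + 1) + p ^ l) → (G →* K),
      (∀ i < p ^ (l + 1), ∃ x, F x a = ω ∧ F x b = ω ^ i) ∧
      (∀ i < p ^ l, ∃ x, F x a = (ω ^ p) ^ i ∧ F x b = ω) := by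
  have hpow : ∀ (k u : ℕ), l + 1 ≤ u → (ω ^ k) ^ (p ^ u) = 1 := fun k u hu => by
    rw [pow_right_comm, aux_pow_one hω hu, one_pow]
  have : ∀ x : Fin (p ^ (l + 1) + p ^ l), ∃ f : G →* K,
      (x.1 < p ^ (l + 1) → f a = ω ∧ f b = ω ^ x.1) ∧
      (¬ x.1 < p ^ (l + 1) → f a = (ω ^ p) ^ (x.1 - p ^ (l + 1)) ∧ f b = ω) := by
    intro x
    by_cases hx : x.1 < p ^ (l + 1)
    · obtain ⟨f, h1, h2⟩ := ex ω (ω ^ x.1) (aux_pow_one hω (by omega)) (hpow _ _ (by omega))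
      exact ⟨f, fun _ => ⟨h1, h2⟩, fun h => absurd hx h⟩
    · obtain ⟨f, h1, h2⟩ := ex ((ω ^ p) ^ (x.1 - p ^ (l + 1))) ω
        (by rw [← pow_mul ω p]; exact hpow _ _ (by omega)) (aux_pow_one hω (by omega))
      exact ⟨f, fun h => absurd h hx, fun _ => ⟨h1, h2⟩⟩
  choose F hF1 hF2 using this
  refine ⟨F, fun i hi => ⟨⟨i, by omega⟩, hF1 _ hi⟩, fun i hi => ⟨⟨p ^ (l + 1) + i, by omega⟩, ?_⟩⟩
  have := hF2 ⟨p ^ (l + 1) + i, by omega⟩ (by simp)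
  simpa using this

lemma aux_c5 {G : Type} [Group G] {a b : G} {p c Q : ℕ} (hp : p.Prime) (hc : 1 ≤ c)
    {K : Type} [Field K] (w₀ ω : K) (hw₀ : IsPrimitiveRoot w₀ (p ^ c))
    (ex : ∀ w : K, IsPrimitiveRoot w (p ^ c) → ∃ f : G →* Matrix (Fin Q) (Fin Q) K,
      (f a) ^ Q = algebraMap K _ w ∧ (f b) ^ Q = algebraMap K _ ω) :
    ∃ F : Fin (p ^ c - p ^ (c - 1)) → (G →* Matrix (Fin Q) (Fin Q) K),
      ∀ w : K, IsPrimitiveRoot w (p ^ c) → ∃ x,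
        (F x a) ^ Q = algebraMap K _ w ∧ (F x b) ^ Q = algebraMap K _ ω := by
  have hcard : (primitiveRoots (p ^ c) K).card = p ^ c - p ^ (c - 1) := by
    rw [hw₀.card_primitiveRoots, Nat.totient_prime_pow hp (by omega), Nat.mul_sub, mul_one,
      ← pow_succ, Nat.sub_add_cancel hc]
  let e := Finset.equivFinOfCardEq hcard
  have : ∀ x : Fin (p ^ c - p ^ (c - 1)), ∃ f : G →* Matrix (Fin Q) (Fin Q) K,
      (f a) ^ Q = algebraMap K _ (e.symm x).1 ∧ (f b) ^ Q = algebraMap K _ ω := fun x =>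
    ex _ ((mem_primitiveRoots (pow_pos hp.pos _)).1 (e.symm x).2)
  choose F hF using this
  refine ⟨F, fun w hw => ⟨e ⟨w, (mem_primitiveRoots (pow_pos hp.pos _)).2 hw⟩, ?_⟩⟩
  simpa using hF (e ⟨w, (mem_primitiveRoots (pow_pos hp.pos _)).2 hw⟩)

lemma aux_inj {G : Type} [Group G] [Fintype G] {a b : G} {p c s m R : ℕ}
    (hp : p.Prime) (hc : 1 ≤ c) (hm : c + s < m)
    (hR : ∀ t ≤ s, orderOf (R : ZMod (p ^ (c + t))) = p ^ t)
    (h : a * b = b * a ^ R)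
    (hbij : Function.Bijective (fun x : Fin (p ^ m) × Fin (p ^ (c + s)) => b ^ x.1.1 * a ^ x.2.1))
    (K : ℕ → Type) [∀ N, Field (K N)] [∀ N, Algebra ℚ (K N)]
    [∀ N, IsCyclotomicExtension {N} ℚ (K N)] [hN : ∀ k, NeZero (p ^ k)]
    (f₁ : G →* ℚ) (hf₁ : f₁ a = 1 ∧ f₁ b = 1)
    (F₂ : ∀ l : Fin c, Fin (p ^ (l.1 + 1) + p ^ l.1) → (G →* K (p ^ (l.1 + 1))))
    (hF₂ : ∀ l : Fin c, (∀ i < p ^ (l.1 + 1), ∃ x,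
        F₂ l x a = IsCyclotomicExtension.zeta (p ^ (l.1 + 1)) ℚ (K (p ^ (l.1 + 1))) ∧
        F₂ l x b = IsCyclotomicExtension.zeta (p ^ (l.1 + 1)) ℚ (K (p ^ (l.1 + 1))) ^ i) ∧
      (∀ i < p ^ l.1, ∃ x,
        F₂ l x a = (IsCyclotomicExtension.zeta (p ^ (l.1 + 1)) ℚ (K (p ^ (l.1 + 1))) ^ p) ^ i ∧
        F₂ l x b = IsCyclotomicExtension.zeta (p ^ (l.1 + 1)) ℚ (K (p ^ (l.1 + 1)))))
    (F₃ : ∀ l : Fin (m - c), Fin (p ^ c) → (G →* K (p ^ (c + 1 + l.1))))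
    (hF₃ : ∀ l i, F₃ l i a =
        (IsCyclotomicExtension.zeta (p ^ (c + 1 + l.1)) ℚ (K (p ^ (c + 1 + l.1))) ^ (p ^ (1 + l.1))) ^ i.1 ∧
      F₃ l i b = IsCyclotomicExtension.zeta (p ^ (c + 1 + l.1)) ℚ (K (p ^ (c + 1 + l.1))))
    (F₄ : ∀ j : Fin s, Fin (p ^ c) →
      (G →* Matrix (Fin (p ^ (j.1 + 1))) (Fin (p ^ (j.1 + 1))) (K (p ^ c))))
    (hF₄ : ∀ j i, (F₄ j i a) ^ (p ^ (j.1 + 1)) =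
        algebraMap (K (p ^ c)) _ (IsCyclotomicExtension.zeta (p ^ c) ℚ (K (p ^ c))) ∧
      (F₄ j i b) ^ (p ^ (j.1 + 1)) =
        algebraMap (K (p ^ c)) _ (IsCyclotomicExtension.zeta (p ^ c) ℚ (K (p ^ c)) ^ i.1))
    (F₅ : ∀ (j : Fin s) (l : Fin (m - (j.1 + 1) - c)), Fin (p ^ c - p ^ (c - 1)) →
      (G →* Matrix (Fin (p ^ (j.1 + 1))) (Fin (p ^ (j.1 + 1))) (K (p ^ (c + 1 + l.1)))))
    (hF₅ : ∀ j l, ∀ w : K (p ^ (c + 1 + l.1)), IsPrimitiveRoot w (p ^ c) → ∃ x,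
      (F₅ j l x a) ^ (p ^ (j.1 + 1)) = algebraMap (K (p ^ (c + 1 + l.1))) _ w ∧
      (F₅ j l x b) ^ (p ^ (j.1 + 1)) = algebraMap (K (p ^ (c + 1 + l.1))) _
        (IsCyclotomicExtension.zeta (p ^ (c + 1 + l.1)) ℚ (K (p ^ (c + 1 + l.1)))))
    (x : MonoidAlgebra ℚ G)
    (h₁ : MonoidAlgebra.lift ℚ ℚ G f₁ x = 0)
    (h₂ : ∀ l i, MonoidAlgebra.lift ℚ _ G (F₂ l i) x = 0)
    (h₃ : ∀ l i, MonoidAlgebra.lift ℚ _ G (F₃ l i) x = 0)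
    (h₄ : ∀ j i, MonoidAlgebra.lift ℚ _ G (F₄ j i) x = 0)
    (h₅ : ∀ j l i, MonoidAlgebra.lift ℚ _ G (F₅ j l i) x = 0) : x = 0 := by
  suffices hx : (fun g => (x.coeff g : ℂ)) = 0 by
    ext g
    have := congrFun hx g
    simpa using this
  refine aux_total (pow_pos hp.pos _) hbij _ fun ζ hζ => ?_
  obtain ⟨u, hu, hζu⟩ := aux_prim hp hζ
  by_cases huc : u ≤ c
  · refine ⟨1, p ^ m, one_pos, pow_pos hp.pos _, by simp, fun η hη => ?_⟩
    obtain ⟨y, hy, hηy⟩ := aux_prim hp hη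
    by_cases hyc : c < y
    · obtain ⟨l, rfl⟩ : ∃ l, y = c + 1 + l := ⟨y - c - 1, by omega⟩
      obtain ⟨σ, hσ⟩ := aux_embed (p ^ (c + 1 + l)) (K (p ^ (c + 1 + l))) η hηy
      have hθ : IsPrimitiveRoot (η ^ (p ^ (1 + l))) (p ^ c) :=
        aux_primpow hp (by rw [← add_assoc]; exact hηy)
      obtain ⟨i, hi, hiζ⟩ := hθ.eq_pow_of_pow_eq_one (aux_pow_one hζu.pow_eq_one huc)
      have hF := hF₃ ⟨l, by omega⟩ ⟨i, hi⟩
      refine aux_char h hbij (F₃ ⟨l, by omega⟩ ⟨i, hi⟩) σ x (h₃ _ _) ζ η ?_ ?_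
      · rw [hF.1, map_pow, map_pow]
        rw [hσ, hiζ]
      · rw [hF.2]; exact hσ
    · by_cases hyu : y ≤ u
      · rcases Nat.eq_zero_or_pos u with rfl | hu0
        · obtain rfl : y = 0 := by omega
          have hζ1 : ζ = 1 := by simpa using hζu.pow_eq_one
          have hη1 : η = 1 := by simpa using hηy.pow_eq_one
          exact aux_char h hbij f₁ (Algebra.ofId ℚ ℂ) x h₁ ζ η (by rw [hf₁.1, map_one, hζ1])
            (by rw [hf₁.2, map_one, hη1])
        · obtain ⟨l, rfl⟩ : ∃ l, u = l + 1 := ⟨u - 1, by omega⟩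
          obtain ⟨σ, hσ⟩ := aux_embed (p ^ (l + 1)) (K (p ^ (l + 1))) ζ hζu
          obtain ⟨i, hi, hiη⟩ := hζu.eq_pow_of_pow_eq_one (aux_pow_one hηy.pow_eq_one hyu)
          obtain ⟨z, hz1, hz2⟩ := (hF₂ ⟨l, by omega⟩).1 i hi
          refine aux_char h hbij (F₂ ⟨l, by omega⟩ z) σ x (h₂ _ _) ζ η ?_ ?_
          · rw [hz1]; exact hσ
          · rw [hz2, map_pow]; rw [hσ, hiη]
      · obtain ⟨l, rfl⟩ : ∃ l, y = l + 1 := ⟨y - 1, by omega⟩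
        obtain ⟨σ, hσ⟩ := aux_embed (p ^ (l + 1)) (K (p ^ (l + 1))) η hηy
        have hθ : IsPrimitiveRoot (η ^ p) (p ^ l) := by
          have := aux_primpow hp hηy
          rwa [pow_one] at this
        obtain ⟨i, hi, hiζ⟩ := hθ.eq_pow_of_pow_eq_one (aux_pow_one hζu.pow_eq_one (by omega))
        obtain ⟨z, hz1, hz2⟩ := (hF₂ ⟨l, by omega⟩).2 i hi
        refine aux_char h hbij (F₂ ⟨l, by omega⟩ z) σ x (h₂ _ _) ζ η ?_ ?_
        · rw [hz1, map_pow, map_pow]; rw [hσ, hiζ]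
        · rw [hz2]; exact hσ
  · obtain ⟨j, rfl⟩ : ∃ j, u = c + (j + 1) := ⟨u - c - 1, by omega⟩
    have hjs : j < s := by omega
    have hQM : p ^ m = p ^ (j + 1) * p ^ (m - (j + 1)) := by
      rw [← pow_add]; congr 1; omega
    refine ⟨p ^ (j + 1), p ^ (m - (j + 1)), pow_pos hp.pos _, pow_pos hp.pos _, hQM, fun η hη => ?_⟩
    have hw : IsPrimitiveRoot (ζ ^ (p ^ (j + 1))) (p ^ c) := aux_primpow hp hζu
    have hR1 : R ≡ 1 [MOD p ^ c] := by
      have := aux_modEq_of_order (hR 0 (by omega))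
      simpa using this
    have hζR : (ζ ^ (p ^ (j + 1))) ^ R = ζ ^ (p ^ (j + 1)) := by
      rw [pow_eq_pow_of_modEq hR1 hw.pow_eq_one, pow_one]
    have hζRQ : ζ ^ (R ^ (p ^ (j + 1))) = ζ := by
      rw [pow_eq_pow_of_modEq (aux_modEq_of_order (hR (j + 1) (by omega))) hζu.pow_eq_one, pow_one]
    have hinj : ∀ i < p ^ (j + 1), ∀ i' < p ^ (j + 1), ζ ^ (R ^ i) = ζ ^ (R ^ i') → i = i' := by
      intro i hi i' hi' he
      have h1 : R ^ i ≡ R ^ i' [MOD p ^ (c + (j + 1))] := by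
        refine hζu.pow_inj (Nat.mod_lt _ (pow_pos hp.pos _)) (Nat.mod_lt _ (pow_pos hp.pos _)) ?_
        rw [hζu.eq_orderOf, pow_mod_orderOf, pow_mod_orderOf]; exact he
      rw [← ZMod.natCast_eq_natCast_iff] at h1
      push_cast at h1
      exact pow_injOn_Iio_orderOf (by rw [hR _ (by omega)]; exact hi)
        (by rw [hR _ (by omega)]; exact hi') h1
    obtain ⟨y, hy, hηy⟩ := aux_prim hp hη
    by_cases hyc : c < y
    · obtain ⟨l, rfl⟩ : ∃ l, y = c + 1 + l := ⟨y - c - 1, by omega⟩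
      obtain ⟨σ, hσ⟩ := aux_embed (p ^ (c + 1 + l)) (K (p ^ (c + 1 + l))) η hηy
      have hθ : IsPrimitiveRoot (η ^ (p ^ (1 + l))) (p ^ c) :=
        aux_primpow hp (by rw [← add_assoc]; exact hηy)
      obtain ⟨i, hi, hiζ⟩ := hθ.eq_pow_of_pow_eq_one hw.pow_eq_one
      have hσw : σ ((IsCyclotomicExtension.zeta (p ^ (c + 1 + l)) ℚ (K (p ^ (c + 1 + l))) ^
          (p ^ (1 + l))) ^ i) = ζ ^ (p ^ (j + 1)) := by
        rw [map_pow, map_pow, hσ, hiζ]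
      have hwp := IsPrimitiveRoot.of_map_of_injective (f := σ) (by rw [hσw]; exact hw)
        σ.toRingHom.injective
      obtain ⟨z, hz1, hz2⟩ := hF₅ ⟨j, hjs⟩ ⟨l, by simp only; omega⟩ _ hwp
      exact aux_comp (pow_pos hp.pos _) h hbij hQM _ σ x (h₅ ⟨j, hjs⟩ ⟨l, by simp only; omega⟩ z)
        _ _ hz1 hz2 ζ η hσw hσ hζR hζRQ hinj
    · obtain ⟨σ, hσ⟩ := aux_embed (p ^ c) (K (p ^ c)) _ hw
      obtain ⟨i, hi, hiη⟩ := hw.eq_pow_of_pow_eq_one (aux_pow_one hηy.pow_eq_one (by omega))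
      have hz := hF₄ ⟨j, hjs⟩ ⟨i, hi⟩
      exact aux_comp (pow_pos hp.pos _) h hbij hQM _ σ x (h₄ ⟨j, hjs⟩ ⟨i, hi⟩)
        _ _ hz.1 hz.2 ζ η hσ (by rw [map_pow, hσ, hiη]) hζR hζRQ hinj

lemma aux_main {G : Type} [Group G] [Finite G] {a b : G} {p c s m R T : ℕ}
    (hp : p.Prime) (hodd : Odd p) (hc : 1 ≤ c) (hm : c + s < m)
    (hR : ∀ t ≤ s, orderOf (R : ZMod (p ^ (c + t))) = p ^ t)
    (hT : ∀ t ≤ s, orderOf (T : ZMod (p ^ (c + t))) = p ^ t)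
    (hRT : R * T ≡ 1 [MOD p ^ (c + s)])
    (h : a * b = b * a ^ R) (hgen : Subgroup.closure {a, b} = ⊤)
    (ha : orderOf a = p ^ (c + s)) (hb : orderOf b = p ^ m)
    (hcard : Nat.card G = p ^ (c + s + m))
    (K : ℕ → Type) [∀ N, Field (K N)] [∀ N, Algebra ℚ (K N)]
    [∀ N, IsCyclotomicExtension {N} ℚ (K N)] :
    Nonempty (MonoidAlgebra ℚ G ≃ₐ[ℚ] ℚ ×
        ((l : Fin c) → Fin (p ^ (l.1 + 1) + p ^ l.1) → K (p ^ (l.1 + 1))) ×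
        ((l : Fin (m - c)) → Fin (p ^ c) → K (p ^ (c + 1 + l.1))) ×
        ((j : Fin s) → Fin (p ^ c) →
          Matrix (Fin (p ^ (j.1 + 1))) (Fin (p ^ (j.1 + 1))) (K (p ^ c))) ×
        ((j : Fin s) → (l : Fin (m - (j.1 + 1) - c)) → Fin (p ^ c - p ^ (c - 1)) →
          Matrix (Fin (p ^ (j.1 + 1))) (Fin (p ^ (j.1 + 1))) (K (p ^ (c + 1 + l.1))))) := by
  have hfin : Fintype G := Fintype.ofFinite G
  have hN : ∀ k, NeZero (p ^ k) := fun k => ⟨(pow_pos hp.pos k).ne'⟩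
  have hfd : ∀ k, FiniteDimensional ℚ (K (p ^ k)) := fun k =>
    IsCyclotomicExtension.finiteDimensional {p ^ k} ℚ (K (p ^ k))
  have hfm : ∀ t k, FiniteDimensional ℚ (Matrix (Fin (p ^ t)) (Fin (p ^ t)) (K (p ^ k))) :=
    fun t k => Module.Finite.matrix
  have hcard' : Nat.card G = p ^ m * p ^ (c + s) := by rw [hcard, ← pow_add, add_comm]
  have hR1 : R ≡ 1 [MOD p ^ c] := by
    have := aux_modEq_of_order (hR 0 (by omega))
    simpa using this
  have hbij := aux_bij h hgen ha hb hcard'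
  have hz : ∀ k, IsPrimitiveRoot (IsCyclotomicExtension.zeta (p ^ k) ℚ (K (p ^ k))) (p ^ k) :=
    fun k => IsCyclotomicExtension.zeta_spec _ _ _
  obtain ⟨f₁, hf₁⟩ := aux_exchar hR1 h hgen ha hb hcard' (1 : ℚ) 1 (one_pow _) (one_pow _)
  have e₂ : ∀ l : Fin c, _ := fun l => aux_c2 (m := m) l.2 (by omega)
    (fun α β hα hβ => aux_exchar hR1 h hgen ha hb hcard' α β hα hβ) _ (hz (l.1 + 1)).pow_eq_one
  choose F₂ hF₂ using e₂
  have e₃ : ∀ (l : Fin (m - c)) (i : Fin (p ^ c)), ∃ f : G →* K (p ^ (c + 1 + l.1)), f a =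
        (IsCyclotomicExtension.zeta (p ^ (c + 1 + l.1)) ℚ (K (p ^ (c + 1 + l.1))) ^ (p ^ (1 + l.1))) ^ i.1 ∧
      f b = IsCyclotomicExtension.zeta (p ^ (c + 1 + l.1)) ℚ (K (p ^ (c + 1 + l.1))) := by
    intro l i
    refine aux_exchar hR1 h hgen ha hb hcard' _ _ ?_ (aux_pow_one (hz _).pow_eq_one (by omega))
    have := hz (c + 1 + l.1)
    rw [pow_right_comm, ← pow_mul _ (p ^ (1 + l.1)), ← pow_add, add_comm (1 + l.1), ← add_assoc,
      this.pow_eq_one, one_pow]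
  choose F₃ hF₃ using e₃
  have e₄ : ∀ (j : Fin s) (i : Fin (p ^ c)), _ := fun j i =>
    aux_exmat hp hodd hc hm hR hT hRT h hgen ha hb hcard' (t := j.1 + 1) (l := c) (by omega) le_rfl
      (by omega) (hz c) (hz c)
      (η := IsCyclotomicExtension.zeta (p ^ c) ℚ (K (p ^ c)) ^ i.1)
      (by rw [pow_right_comm, (hz c).pow_eq_one, one_pow])
  choose F₄ hF₄ using e₄
  have e₅ : ∀ (j : Fin s) (l : Fin (m - (j.1 + 1) - c)), _ := fun j l =>
    aux_c5 (G := G) (a := a) (b := b) (Q := p ^ (j.1 + 1)) hp hc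
      (IsCyclotomicExtension.zeta (p ^ (c + 1 + l.1)) ℚ (K (p ^ (c + 1 + l.1))) ^ (p ^ (1 + l.1)))
      (IsCyclotomicExtension.zeta (p ^ (c + 1 + l.1)) ℚ (K (p ^ (c + 1 + l.1))))
      (aux_primpow hp (by rw [← add_assoc]; exact hz _))
      (fun w hw => aux_exmat hp hodd hc hm hR hT hRT h hgen ha hb hcard' (t := j.1 + 1)
        (l := c + 1 + l.1) (by omega) (by omega) (by omega) (hz _) hw (hz _).pow_eq_one)
  choose F₅ hF₅ using e₅
  let Φ : MonoidAlgebra ℚ G →ₐ[ℚ] ℚ ×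
        ((l : Fin c) → Fin (p ^ (l.1 + 1) + p ^ l.1) → K (p ^ (l.1 + 1))) ×
        ((l : Fin (m - c)) → Fin (p ^ c) → K (p ^ (c + 1 + l.1))) ×
        ((j : Fin s) → Fin (p ^ c) →
          Matrix (Fin (p ^ (j.1 + 1))) (Fin (p ^ (j.1 + 1))) (K (p ^ c))) ×
        ((j : Fin s) → (l : Fin (m - (j.1 + 1) - c)) → Fin (p ^ c - p ^ (c - 1)) →
          Matrix (Fin (p ^ (j.1 + 1))) (Fin (p ^ (j.1 + 1))) (K (p ^ (c + 1 + l.1)))) :=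
    AlgHom.prod (MonoidAlgebra.lift ℚ _ G f₁) <|
    AlgHom.prod (Pi.algHom ℚ _ fun l => Pi.algHom ℚ _ fun i => MonoidAlgebra.lift ℚ _ G (F₂ l i)) <|
    AlgHom.prod (Pi.algHom ℚ _ fun l => Pi.algHom ℚ _ fun i => MonoidAlgebra.lift ℚ _ G (F₃ l i)) <|
    AlgHom.prod (Pi.algHom ℚ _ fun j => Pi.algHom ℚ _ fun i => MonoidAlgebra.lift ℚ _ G (F₄ j i))
      (Pi.algHom ℚ _ fun j => Pi.algHom ℚ _ fun l => Pi.algHom ℚ _ fun i =>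
        MonoidAlgebra.lift ℚ _ G (F₅ j l i))
  have hinj : Function.Injective Φ.toLinearMap := by
    rw [← LinearMap.ker_eq_bot, LinearMap.ker_eq_bot']
    intro x hx
    have hx : Φ x = 0 := hx
    refine aux_inj hp hc hm hR h hbij K f₁ hf₁ F₂ hF₂ F₃ hF₃ F₄ hF₄ F₅ hF₅ x ?_ ?_ ?_ ?_ ?_
    · exact congrArg (fun z => z.1) hx
    · intro l i; exact congrArg (fun z => z.2.1 l i) hx
    · intro l i; exact congrArg (fun z => z.2.2.1 l i) hx
    · intro l i; exact congrArg (fun z => z.2.2.2.1 l i) hx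
    · intro j l i; exact congrArg (fun z => z.2.2.2.2 j l i) hx
  have hfr := aux_finrank p c s m hp hc (by omega) hcard K
  have hfG : FiniteDimensional ℚ (MonoidAlgebra ℚ G) :=
    Module.Finite.equiv (MonoidAlgebra.coeffLinearEquiv ℚ).symm
  have hsurj := (LinearMap.injective_iff_surjective_of_finrank_eq_finrank hfr).1 hinj
  exact ⟨AlgEquiv.ofBijective Φ ⟨hinj, hsurj⟩⟩

/-- **Theorem (Wedderburn decomposition, case `n - s < m`, `k > s`).**
Let `p` be an odd prime and let
`G = ⟨a, b | a^(p^n) = b^(p^m) = 1, b a b⁻¹ = a^r⟩` be the split metacyclic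
`p`-group, with `n ≥ 2`, `m ≥ 1`, `gcd(r, p^n) = 1`, `r` of multiplicative
order `p^s` modulo `p^n` and `1 ≤ s ≤ min {n-1, m}`.  (Such a group is
characterized up to isomorphism by: `|G| = p^(n+m)`, generators `a, b` of
orders `p^n`, `p^m` with `b a b⁻¹ = a^r`.)  Suppose `n - s < m`,
`m = (n-s) + k` and `k > s`.  Then
`ℚG ≅ ℚ ⊕ ⨁_{λ=1}^{n-s} (p^λ + p^(λ-1)) ℚ(ζ_{p^λ})
     ⊕ ⨁_{λ=n-s+1}^{m} p^(n-s) ℚ(ζ_{p^λ})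
     ⊕ ⨁_{t=1}^{s} p^(n-s) M_{p^t}(ℚ(ζ_{p^(n-s)}))
     ⊕ ⨁_{t=1}^{s} ⨁_{λ=n-s+1}^{m-t} (p^(n-s) − p^(n-s-1)) M_{p^t}(ℚ(ζ_{p^λ}))`
as `ℚ`-algebras.  (Sums over `λ = 1..n-s`, `λ = n-s+1..m`, and `t = 1..s` are
reindexed by `l : Fin (n-s)` with `λ = l+1`, `l : Fin (m-(n-s))` with
`λ = n-s+1+l`, and `j : Fin s` with `t = j+1`, respectively.) -/
theorem stmt_2 (p n m s k : ℕ) (r : ℤ) (hp : p.Prime) (hodd : Odd p)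
    (hn : 2 ≤ n) (hm : 1 ≤ m) (hs1 : 1 ≤ s) (hsn : s ≤ n - 1) (hsm : s ≤ m)
    (hr : Int.gcd r (p ^ n) = 1) (hord : orderOf ((r : ZMod (p ^ n))) = p ^ s)
    (G : Type) [Group G] (a b : G)
    (hcard : Nat.card G = p ^ (n + m))
    (ha : orderOf a = p ^ n) (hb : orderOf b = p ^ m)
    (hrel : b * a * b⁻¹ = a ^ r)
    (hgen : Subgroup.closure {a, b} = ⊤)
    (hcase : n - s < m) (hk : m = (n - s) + k) (hks : s < k) :
    Nonempty
      (MonoidAlgebra ℚ G ≃ₐ[ℚ]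
        ℚ ×
        ((l : Fin (n - s)) → Fin (p ^ (l.1 + 1) + p ^ l.1) →
          CyclotomicField (p ^ (l.1 + 1)) ℚ) ×
        ((l : Fin (m - (n - s))) → Fin (p ^ (n - s)) →
          CyclotomicField (p ^ (n - s + 1 + l.1)) ℚ) ×
        ((j : Fin s) → Fin (p ^ (n - s)) →
          Matrix (Fin (p ^ (j.1 + 1))) (Fin (p ^ (j.1 + 1)))
            (CyclotomicField (p ^ (n - s)) ℚ)) ×
        ((j : Fin s) → (l : Fin (m - (j.1 + 1) - (n - s))) →
          Fin (p ^ (n - s) - p ^ (n - s - 1)) →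
          Matrix (Fin (p ^ (j.1 + 1))) (Fin (p ^ (j.1 + 1)))
            (CyclotomicField (p ^ (n - s + 1 + l.1)) ℚ))) := by
  obtain ⟨c, hcdef⟩ : ∃ c, c = n - s := ⟨_, rfl⟩
  rw [← hcdef] at hcase hk
  rw [← hcdef]
  obtain rfl : n = c + s := by omega
  have hc : 1 ≤ c := by omega
  have hpn : 1 < p ^ (c + s) := Nat.one_lt_pow (by omega) hp.one_lt
  have hne : NeZero (p ^ (c + s)) := ⟨by omega⟩
  have hfin : Finite G := Nat.finite_of_card_ne_zero (by rw [hcard]; exact (pow_pos hp.pos _).ne')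
  have hunit : IsUnit (r : ZMod (p ^ (c + s))) := by
    apply IsUnit.of_pow_eq_one (n := p ^ s) _ (pow_pos hp.pos _).ne'
    rw [← hord]; exact pow_orderOf_eq_one _
  obtain ⟨ru, hru⟩ := hunit
  let R : ℕ := (ru⁻¹ : (ZMod (p ^ (c + s)))ˣ).1.val
  let T : ℕ := (ru : ZMod (p ^ (c + s))).val
  have hRc : (R : ZMod (p ^ (c + s))) = (ru⁻¹ : (ZMod (p ^ (c + s)))ˣ) := ZMod.natCast_zmod_val _
  have hTc : (T : ZMod (p ^ (c + s))) = (r : ZMod (p ^ (c + s))) := by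
    rw [← hru]; exact ZMod.natCast_zmod_val _
  have hTord : orderOf (T : ZMod (p ^ (c + s))) = p ^ s := by rw [hTc, hord]
  have hRord : orderOf (R : ZMod (p ^ (c + s))) = p ^ s := by
    rw [hRc, orderOf_units, orderOf_inv, ← orderOf_units, hru, hord]
  have hRT : R * T ≡ 1 [MOD p ^ (c + s)] := by
    rw [← ZMod.natCast_eq_natCast_iff]
    push_cast
    rw [hRc, hTc, ← hru, ← Units.val_mul, inv_mul_cancel, Units.val_one]
  have hT' : b * a * b⁻¹ = a ^ T := by
    rw [hrel, ← zpow_natCast]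
    apply zpow_eq_zpow_iff_modEq.2
    rw [ha]
    refine (ZMod.intCast_eq_intCast_iff _ _ _).1 ?_
    rw [← hTc]; simp
  have h : a * b = b * a ^ R := by
    have h1 : (b * a * b⁻¹) ^ R = a := by
      rw [hT', ← pow_mul, mul_comm, pow_eq_pow_of_modEq hRT (by rw [← ha]; exact pow_orderOf_eq_one a),
        pow_one]
    rw [conj_pow] at h1
    nth_rewrite 1 [← h1]
    simp [mul_assoc]
  have hRo := aux_order hp hodd hs1 hsn hRord
  have hTo := aux_order hp hodd hs1 hsn hTord
  rw [Nat.add_sub_cancel] at hRo hTo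
  have hcyc : ∀ N : ℕ, IsCyclotomicExtension {N} ℚ (CyclotomicField N ℚ) := fun N => by
    convert (inferInstance : @IsCyclotomicExtension {N} ℚ (CyclotomicField N ℚ) _ _
      (CyclotomicField.algebra N ℚ))
    exact Subsingleton.elim _ _
  exact aux_main hp hodd hc (by omega) hRo hTo hRT h hgen ha hb hcard
    (fun N => CyclotomicField N ℚ)
end

section
/- Let p be an odd prime and n ≥ m ≥ 1 integers, and let A = C_{p^n} × C_{p^m} be the direct product of cyclic groups of orders p^n and p^m. Then there is an isomorphism of ℚ-algebras ℚA ≅ ℚ ⊕ ⨁_{λ=1}^{m} (p^λ + p^{λ−1}) copies of ℚ(ζ_{p^λ}) ⊕ ⨁_{λ=m+1}^{n} p^m copies of ℚ(ζ_{p^λ}). -/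
theorem aux_sub (N b b' : ℕ) (hb : b < N) (hb' : b' < N) (h : N ∣ (N - 1) * b + b') : b = b' := by
  have hN : 1 ≤ N := by omega
  have h2 : (N : ℤ) ∣ ((b' : ℤ) - b) := by
    have h3 : (N : ℤ) ∣ (((N - 1) * b + b' : ℕ) : ℤ) := by exact_mod_cast h
    push_cast [Nat.cast_sub hN] at h3
    have : ((b' : ℤ) - b) = (((N : ℤ) - 1) * b + b') - N * b := by ring
    rw [this]
    exact dvd_sub h3 (Dvd.intro _ rfl)
  have := Int.eq_zero_of_abs_lt_dvd h2 (by rw [abs_lt]; constructor <;> omega)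
  omega

theorem aux_pi_surj {R : Type*} [CommRing R] [Algebra ℚ R] {ι : Type*} [Finite ι] {K : ι → Type*}
    [∀ i, Field (K i)] [∀ i, Algebra ℚ (K i)] (f : ∀ i, R →ₐ[ℚ] K i)
    (hf : ∀ i, Function.Surjective (f i))
    (hk : ∀ i j, (∀ r, f i r = 0 ↔ f j r = 0) → i = j) :
    Function.Surjective (AlgHom.pi f) := by
  intro y
  choose x hx using fun i => hf i (y i)
  have hmax : ∀ i, (RingHom.ker (f i)).IsMaximal := fun i =>
    RingHom.ker_isMaximal_of_surjective (f i) (hf i)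
  obtain ⟨r, hr⟩ := Ideal.exists_forall_sub_mem_ideal (I := fun i => RingHom.ker (f i))
    (by
      intro i j hij
      have := hmax i
      have := hmax j
      refine Ideal.isCoprime_of_isMaximal ?_
      intro h
      apply hij
      apply hk
      intro r
      rw [← RingHom.mem_ker, ← RingHom.mem_ker]
      exact iff_of_eq (congrArg (fun I : Ideal R => r ∈ I) h)) x
  refine ⟨r, ?_⟩
  funext i
  have := hr i
  rw [RingHom.mem_ker, map_sub, sub_eq_zero] at this
  simpa [hx] using this

theorem aux_cyc (N : ℕ) [NeZero N] : IsCyclotomicExtension {N} ℚ (CyclotomicField N ℚ) := by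
  have : NeZero ((N : ℕ) : ℚ) := inferInstance
  have := CyclotomicField.isCyclotomicExtension N ℚ
  exact this

theorem aux_char_s6 (p n m d u v : ℕ) (hp : p.Prime) (hu : p ^ d ∣ u * p ^ n) (hv : p ^ d ∣ v * p ^ m)
    (huv : Nat.Coprime u (p ^ d) ∨ Nat.Coprime v (p ^ d)) :
    ∃ f : MonoidAlgebra ℚ (Multiplicative (ZMod (p ^ n)) × Multiplicative (ZMod (p ^ m))) →ₐ[ℚ]
      CyclotomicField (p ^ d) ℚ, Function.Surjective f ∧
      ∀ a b : ℕ, f (MonoidAlgebra.of ℚ _ (Multiplicative.ofAdd (a : ZMod (p ^ n)),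
        Multiplicative.ofAdd (b : ZMod (p ^ m))) - 1) = 0 ↔ p ^ d ∣ u * a + v * b := by
  have : NeZero p := ⟨hp.ne_zero⟩
  have := aux_cyc (p ^ d)
  have hζ := IsCyclotomicExtension.zeta_spec (p ^ d) ℚ (CyclotomicField (p ^ d) ℚ)
  set ζ := IsCyclotomicExtension.zeta (p ^ d) ℚ (CyclotomicField (p ^ d) ℚ) with hζd
  have h1 : (ζ ^ u) ^ (p ^ n) = 1 := by rw [← pow_mul, hζ.pow_eq_one_iff_dvd]; exact hu
  have h2 : (ζ ^ v) ^ (p ^ m) = 1 := by rw [← pow_mul, hζ.pow_eq_one_iff_dvd]; exact hv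
  let χ := ((AddChar.zmodChar (p ^ n) h1).toMonoidHom).coprod
    ((AddChar.zmodChar (p ^ m) h2).toMonoidHom)
  have hχ : ∀ a b : ℕ, χ (Multiplicative.ofAdd (a : ZMod (p ^ n)),
        Multiplicative.ofAdd (b : ZMod (p ^ m))) = ζ ^ (u * a + v * b) := by
    intro a b
    have : χ (Multiplicative.ofAdd (a : ZMod (p ^ n)),
        Multiplicative.ofAdd (b : ZMod (p ^ m))) =
        AddChar.zmodChar (p ^ n) h1 a * AddChar.zmodChar (p ^ m) h2 b := rfl
    rw [this, AddChar.zmodChar_apply', AddChar.zmodChar_apply', pow_add, pow_mul, pow_mul]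
  refine ⟨MonoidAlgebra.lift ℚ _ _ χ, ?_, ?_⟩
  · rw [← AlgHom.range_eq_top, eq_top_iff]
    have key : ∃ w a b : ℕ, IsPrimitiveRoot (ζ ^ (u * a + v * b)) (p ^ d) := by
      rcases huv with h | h
      · exact ⟨0, 1, 0, by simpa using hζ.pow_of_coprime u h⟩
      · exact ⟨0, 0, 1, by simpa using hζ.pow_of_coprime v h⟩
    obtain ⟨_, a, b, hab⟩ := key
    rw [← IsCyclotomicExtension.adjoin_primitive_root_eq_top (A := ℚ) hab]
    rw [Algebra.adjoin_le_iff, Set.singleton_subset_iff]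
    refine ⟨MonoidAlgebra.of ℚ _ (Multiplicative.ofAdd (a : ZMod (p ^ n)),
        Multiplicative.ofAdd (b : ZMod (p ^ m))), ?_⟩
    rw [← hχ]
    exact MonoidAlgebra.lift_of χ _
  · intro a b
    rw [map_sub, map_one, MonoidAlgebra.lift_of, hχ, sub_eq_zero, hζ.pow_eq_one_iff_dvd]

abbrev AuxI (p n m : ℕ) := Unit ⊕ (Σ l : Fin m, Fin (p ^ (l.1 + 1) + p ^ l.1)) ⊕
  (Σ _ : Fin (n - m), Fin (p ^ m))

abbrev auxD (p n m : ℕ) : AuxI p n m → ℕ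
  | .inl _ => 0
  | .inr (.inl x) => x.1.1 + 1
  | .inr (.inr x) => m + 1 + x.1.1

def auxU (p n m : ℕ) : AuxI p n m → ℕ
  | .inl _ => 1
  | .inr (.inl x) => if x.2.1 < p ^ (x.1.1 + 1) then 1 else p * (x.2.1 - p ^ (x.1.1 + 1))
  | .inr (.inr _) => 1

def auxV (p n m : ℕ) : AuxI p n m → ℕ
  | .inl _ => 0
  | .inr (.inl x) => if x.2.1 < p ^ (x.1.1 + 1) then x.2.1 else 1
  | .inr (.inr x) => p ^ (x.1.1 + 1) * x.2.1

theorem aux_inj_s6 (p n m : ℕ) (hp : p.Prime) (i j : AuxI p n m)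
    (hd : auxD p n m i = auxD p n m j)
    (h : ∀ a b : ℕ, p ^ auxD p n m i ∣ auxU p n m i * a + auxV p n m i * b →
      p ^ auxD p n m i ∣ auxU p n m j * a + auxV p n m j * b) 
    (h' : ∀ a b : ℕ, p ^ auxD p n m i ∣ auxU p n m j * a + auxV p n m j * b →
      p ^ auxD p n m i ∣ auxU p n m i * a + auxV p n m i * b) : i = j := by
  have hp1 := hp.one_lt
  -- impossible mixed case
  have mixed : ∀ l b c : ℕ, ¬ p ^ (l + 1) ∣ p * c * ((p ^ (l + 1) - 1) * b) + 1 * 1 := by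
    intro l b c hh
    have h1 : p ∣ p * c * ((p ^ (l + 1) - 1) * b) + 1 * 1 :=
      (dvd_pow_self p (Nat.succ_ne_zero l)).trans hh
    have h2 : p ∣ 1 * 1 := (Nat.dvd_add_right (by rw [mul_assoc]; exact Dvd.intro _ rfl)).mp h1
    have h3 := Nat.le_of_dvd (by norm_num) h2
    omega
  have triv : ∀ N b : ℕ, 0 < N → N ∣ (N - 1) * b + b := by
    intro N b hN
    obtain ⟨k, rfl⟩ : ∃ k, N = k + 1 := ⟨N - 1, by omega⟩
    exact ⟨b, by rw [Nat.add_sub_cancel]; ring⟩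
  match i, j with
  | .inl _, .inl _ => rfl
  | .inl _, .inr (.inl x) => simp [auxD] at hd
  | .inl _, .inr (.inr x) => simp only [auxD] at hd; omega
  | .inr (.inl x), .inl _ => simp [auxD] at hd
  | .inr (.inr x), .inl _ => simp only [auxD] at hd; omega
  | .inr (.inl x), .inr (.inr y) => simp only [auxD] at hd; have := x.1.2; omega
  | .inr (.inr y), .inr (.inl x) => simp only [auxD] at hd; have := x.1.2; omega
  | .inr (.inr ⟨l, b⟩), .inr (.inr ⟨l', b'⟩) =>
    have : l = l' := by simp only [auxD] at hd; ext; omega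
    subst this
    simp only [auxD, auxU, auxV] at h
    have hN : 0 < p ^ m := Nat.pow_pos hp.pos
    have e : p ^ (m + 1 + l.1) = p ^ (l.1 + 1) * p ^ m := by ring
    have h1 := h (p ^ (l.1 + 1) * ((p ^ m - 1) * b.1)) 1 (by
      rw [e, show 1 * (p ^ (l.1 + 1) * ((p ^ m - 1) * b.1)) + p ^ (l.1 + 1) * b.1 * 1 =
        p ^ (l.1 + 1) * ((p ^ m - 1) * b.1 + b.1) by ring]
      exact mul_dvd_mul_left _ (triv _ _ hN))
    rw [e, show 1 * (p ^ (l.1 + 1) * ((p ^ m - 1) * b.1)) + p ^ (l.1 + 1) * b'.1 * 1 =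
        p ^ (l.1 + 1) * ((p ^ m - 1) * b.1 + b'.1) by ring] at h1
    have h2 := Nat.dvd_of_mul_dvd_mul_left (Nat.pow_pos hp.pos) h1
    have : b = b' := Fin.ext (aux_sub _ _ _ b.2 b'.2 h2)
    rw [this]
  | .inr (.inl ⟨l, b⟩), .inr (.inl ⟨l', b'⟩) =>
    have : l = l' := by simp only [auxD] at hd; ext; omega
    subst this
    simp only [auxD, auxU, auxV] at h h'
    have hN : 0 < p ^ (l.1 + 1) := Nat.pow_pos hp.pos
    have hN' : 0 < p ^ l.1 := Nat.pow_pos hp.pos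
    by_cases c : b.1 < p ^ (l.1 + 1) <;> by_cases c' : b'.1 < p ^ (l.1 + 1)
    · simp only [c, c', if_true] at h
      have h1 := h ((p ^ (l.1 + 1) - 1) * b.1) 1 (by simpa using triv _ _ hN)
      have : b = b' := Fin.ext (aux_sub _ _ _ c c' (by simpa using h1))
      rw [this]
    · simp only [c, c', if_true, if_false] at h
      have h1 := h ((p ^ (l.1 + 1) - 1) * b.1) 1 (by simpa using triv _ _ hN)
      exact absurd h1 (mixed _ _ _)
    · simp only [c, c', if_true, if_false] at h'
      have h1 := h' ((p ^ (l.1 + 1) - 1) * b'.1) 1 (by simpa using triv _ _ hN)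
      exact absurd h1 (mixed _ _ _)
    · simp only [c, c', if_false] at h
      have hb := b.2
      have hb' := b'.2
      generalize hk : b.1 - p ^ (l.1 + 1) = k at h
      generalize hk' : b'.1 - p ^ (l.1 + 1) = k' at h
      have e : p ^ (l.1 + 1) = p * p ^ l.1 := by ring
      have h1 := h 1 (p * ((p ^ l.1 - 1) * k)) (by
        rw [e, show p * k * 1 + 1 * (p * ((p ^ l.1 - 1) * k)) =
          p * ((p ^ l.1 - 1) * k + k) by ring]
        exact mul_dvd_mul_left _ (triv _ _ hN'))
      rw [e, show p * k' * 1 + 1 * (p * ((p ^ l.1 - 1) * k)) =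
          p * ((p ^ l.1 - 1) * k + k') by ring] at h1
      have h2 := Nat.dvd_of_mul_dvd_mul_left hp.pos h1
      have := aux_sub _ _ _ (by omega) (by omega) h2
      have : b = b' := Fin.ext (by omega)
      rw [this]

theorem aux_cop (p n m : ℕ) (i : AuxI p n m) :
    Nat.Coprime (auxU p n m i) (p ^ auxD p n m i) ∨
    Nat.Coprime (auxV p n m i) (p ^ auxD p n m i) := by
  match i with
  | .inl _ => left; simp [auxU]
  | .inr (.inl x) =>
    simp only [auxU, auxV]
    split_ifs <;> simp
  | .inr (.inr x) => left; simp [auxU]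

theorem aux_dvdU (p n m : ℕ) (hnm : m ≤ n) (i : AuxI p n m) :
    p ^ auxD p n m i ∣ auxU p n m i * p ^ n := by
  apply Dvd.dvd.mul_left
  apply pow_dvd_pow
  match i with
  | .inl _ => simp
  | .inr (.inl x) => have := x.1.2; simp only [auxD]; omega
  | .inr (.inr x) => have := x.1.2; simp only [auxD]; omega

theorem aux_dvdV (p n m : ℕ) (i : AuxI p n m) :
    p ^ auxD p n m i ∣ auxV p n m i * p ^ m := by
  match i with
  | .inl _ => simp
  | .inr (.inl x) =>
    apply Dvd.dvd.mul_left
    apply pow_dvd_pow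
    have := x.1.2; simp only [auxD]; omega
  | .inr (.inr x) =>
    simp only [auxD, auxV]
    exact ⟨x.2.1, by ring⟩

theorem aux_le (p d d' u v : ℕ) (hp : p.Prime)
    (huv : Nat.Coprime u (p ^ d) ∨ Nat.Coprime v (p ^ d))
    (h : ∀ a b : ℕ, p ^ d' ∣ a → p ^ d' ∣ b → p ^ d ∣ u * a + v * b) : d ≤ d' := by
  rw [← Nat.pow_dvd_pow_iff_le_right hp.one_lt]
  rcases huv with c | c
  · have := h (p ^ d') 0 dvd_rfl (dvd_zero _)
    exact c.symm.dvd_of_dvd_mul_left (by simpa using this)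
  · have := h 0 (p ^ d') (dvd_zero _) dvd_rfl
    exact c.symm.dvd_of_dvd_mul_left (by simpa using this)

theorem aux_count (p n m : ℕ) (hp : p.Prime) (hnm : m ≤ n) :
    1 + ((∑ l : Fin m, (p ^ (l.1 + 1) + p ^ l.1) * (p ^ (l.1 + 1)).totient) +
      ∑ l : Fin (n - m), p ^ m * (p ^ (m + 1 + l.1)).totient) = p ^ n * p ^ m := by
  obtain ⟨k, rfl⟩ := Nat.exists_eq_add_of_le hnm
  obtain ⟨q, rfl⟩ : ∃ q, p = q + 1 := ⟨p - 1, by have := hp.pos; omega⟩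
  rw [Nat.add_sub_cancel_left]
  rw [Fin.sum_univ_eq_sum_range (fun l => ((q+1) ^ (l + 1) + (q+1) ^ l) * ((q+1) ^ (l + 1)).totient),
    Fin.sum_univ_eq_sum_range (fun l => (q+1) ^ m * ((q+1) ^ (m + 1 + l)).totient)]
  have h1 : ∀ m, 1 + ∑ l ∈ Finset.range m, ((q+1) ^ (l + 1) + (q+1) ^ l) * ((q+1) ^ (l + 1)).totient
      = (q+1) ^ m * (q+1) ^ m := by
    intro m
    induction m with
    | zero => simp
    | succ m ih =>
      rw [Finset.sum_range_succ, ← add_assoc, ih, Nat.totient_prime_pow_succ hp]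
      simp only [Nat.add_sub_cancel]
      ring
  rw [← add_assoc, h1]
  clear h1 hnm
  induction k with
  | zero => simp
  | succ k ih =>
    rw [Finset.sum_range_succ, ← add_assoc, ih, show m + 1 + k = m + k + 1 by ring,
      Nat.totient_prime_pow_succ hp]
    simp only [Nat.add_sub_cancel]
    ring

theorem aux_finrank_cyc (N : ℕ) (hN : 0 < N) :
    Module.finrank ℚ (CyclotomicField N ℚ) = N.totient := by
  have : NeZero N := ⟨hN.ne'⟩
  have := aux_cyc N
  exact IsCyclotomicExtension.finrank _ (Polynomial.cyclotomic.irreducible_rat hN)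

theorem aux_finrank_alg (A : Type) [Group A] [Fintype A] :
    Module.finrank ℚ (MonoidAlgebra ℚ A) = Fintype.card A := by
  rw [← Module.finrank_finsupp_self ℚ]
  exact (MonoidAlgebra.coeffLinearEquiv ℚ).finrank_eq

theorem aux_main_s6 (p n m : ℕ) (hp : p.Prime) (hnm : m ≤ n) :
    ∃ f : MonoidAlgebra ℚ (Multiplicative (ZMod (p ^ n)) × Multiplicative (ZMod (p ^ m))) →ₐ[ℚ]
      ((i : AuxI p n m) → CyclotomicField (p ^ auxD p n m i) ℚ), Function.Surjective f := by
  choose f hf hfk using fun i => aux_char_s6 p n m (auxD p n m i) (auxU p n m i) (auxV p n m i) hp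
    (aux_dvdU p n m hnm i) (aux_dvdV p n m i) (aux_cop p n m i)
  refine ⟨AlgHom.pi f, aux_pi_surj f hf ?_⟩
  intro i j hij
  have key : ∀ a b : ℕ, p ^ auxD p n m i ∣ auxU p n m i * a + auxV p n m i * b ↔
      p ^ auxD p n m j ∣ auxU p n m j * a + auxV p n m j * b := by
    intro a b
    rw [← hfk, ← hfk, hij]
  have hd : auxD p n m i = auxD p n m j := by
    apply le_antisymm
    · exact aux_le p _ _ _ _ hp (aux_cop p n m i) fun a b ha hb =>
        (key a b).2 (dvd_add (ha.mul_left _) (hb.mul_left _))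
    · exact aux_le p _ _ _ _ hp (aux_cop p n m j) fun a b ha hb =>
        (key a b).1 (dvd_add (ha.mul_left _) (hb.mul_left _))
  apply aux_inj_s6 p n m hp i j hd
  · intro a b h
    rw [key] at h
    rwa [hd]
  · intro a b h
    rw [key]
    rwa [← hd]


set_option synthInstance.maxHeartbeats 1000000
set_option maxHeartbeats 1000000
/-- **Proposition (Wedderburn decomposition of `ℚ(C_{p^n} × C_{p^m})`).**
Let `p` be an odd prime and `n ≥ m ≥ 1`. Then
`ℚ(C_{p^n} × C_{p^m}) ≅ ℚ ⊕ ⨁_{λ=1}^{m} (p^λ + p^(λ-1)) ℚ(ζ_{p^λ})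
  ⊕ ⨁_{λ=m+1}^{n} p^m ℚ(ζ_{p^λ})`
as `ℚ`-algebras.  (The middle factor is indexed by `λ = l+1` for `l : Fin m`;
the last by `λ = m+1+l` for `l : Fin (n-m)`.) -/
theorem stmt_6 (p n m : ℕ) (hp : p.Prime) (hodd : Odd p) (hm : 1 ≤ m) (hnm : m ≤ n) :
    Nonempty
      (MonoidAlgebra ℚ (Multiplicative (ZMod (p ^ n)) × Multiplicative (ZMod (p ^ m)))
        ≃ₐ[ℚ]
      ℚ ×
      ((l : Fin m) → Fin (p ^ (l.1 + 1) + p ^ l.1) →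
        CyclotomicField (p ^ (l.1 + 1)) ℚ) ×
      ((l : Fin (n - m)) → Fin (p ^ m) →
        CyclotomicField (p ^ (m + 1 + l.1)) ℚ)) := by
  have : NeZero p := ⟨hp.ne_zero⟩
  obtain ⟨f, hf⟩ := aux_main_s6 p n m hp hnm
  have hfr : ∀ d, Module.finrank ℚ (CyclotomicField (p ^ d) ℚ) = (p ^ d).totient := fun d =>
    aux_finrank_cyc _ (Nat.pow_pos hp.pos)
  have h0 : Module.finrank ℚ (CyclotomicField (p ^ 0) ℚ) = 1 := by rw [hfr]; simp
  have hbij : Function.Bijective (Algebra.ofId ℚ (CyclotomicField (p ^ 0) ℚ)) := by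
    have hi : Function.Injective (Algebra.ofId ℚ (CyclotomicField (p ^ 0) ℚ)).toLinearMap :=
      (algebraMap ℚ (CyclotomicField (p ^ 0) ℚ)).injective
    refine ⟨hi, ?_⟩
    exact (LinearMap.injective_iff_surjective_of_finrank_eq_finrank (by rw [h0]; simp)).1 hi
  let e := (AlgEquiv.ofBijective _ hbij).symm
  let K := fun i : AuxI p n m => CyclotomicField (p ^ auxD p n m i) ℚ
  let g : ((i : AuxI p n m) → K i) →ₐ[ℚ] (ℚ ×
      ((l : Fin m) → Fin (p ^ (l.1 + 1) + p ^ l.1) →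
        CyclotomicField (p ^ (l.1 + 1)) ℚ) ×
      ((l : Fin (n - m)) → Fin (p ^ m) →
        CyclotomicField (p ^ (m + 1 + l.1)) ℚ)) :=
    AlgHom.prod (e.toAlgHom.comp (Pi.evalAlgHom ℚ K (.inl ())))
      (AlgHom.prod (AlgHom.pi fun l => AlgHom.pi fun j => Pi.evalAlgHom ℚ K (.inr (.inl ⟨l, j⟩)))
        (AlgHom.pi fun l => AlgHom.pi fun j => Pi.evalAlgHom ℚ K (.inr (.inr ⟨l, j⟩))))
  have hg : Function.Surjective g := by
    rintro ⟨a, b, c⟩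
    refine ⟨fun i => match i with
      | .inl _ => e.symm a
      | .inr (.inl x) => b x.1 x.2
      | .inr (.inr x) => c x.1 x.2, ?_⟩
    exact Prod.ext (e.apply_symm_apply a) rfl
  have hs : Function.Surjective (g.comp f) := hg.comp hf
  have hdim : Module.finrank ℚ
      (MonoidAlgebra ℚ (Multiplicative (ZMod (p ^ n)) × Multiplicative (ZMod (p ^ m)))) =
      Module.finrank ℚ (ℚ ×
      ((l : Fin m) → Fin (p ^ (l.1 + 1) + p ^ l.1) →
        CyclotomicField (p ^ (l.1 + 1)) ℚ) ×
      ((l : Fin (n - m)) → Fin (p ^ m) →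
        CyclotomicField (p ^ (m + 1 + l.1)) ℚ)) := by
    rw [aux_finrank_alg, Module.finrank_prod, Module.finrank_prod, Module.finrank_pi_fintype,
      Module.finrank_pi_fintype]
    simp only [Module.finrank_pi_fintype, hfr, Module.finrank_self, Finset.sum_const,
      Finset.card_univ, Fintype.card_fin, smul_eq_mul]
    rw [aux_count p n m hp hnm]
    simp [ZMod.card]
  have hi : Function.Injective (g.comp f).toLinearMap :=
    (LinearMap.injective_iff_surjective_of_finrank_eq_finrank hdim).2 hs
  exact ⟨AlgEquiv.ofBijective (g.comp f) ⟨hi, hs⟩⟩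
end
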